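/- arXiv:2302.01461 — 2 statements merged into one kernel-verified Lean document; each statement's English description precedes it below -/
import Mathlib

section
/- Assume (H1), (H2), (H3), (H4'), (H5), (H6) and (H7). Then there exists α̂ > 0 such that for each α ∈ (0,α̂] there exists ρ ∈ Λ with the following property: for every Borel probability measure μ on X with ∫_X f dμ < ∞ and W_{ρ_{γα}}(μ, μ_{θ₀}) < ∞ (γ the constant from (H1)), and for every sequence (θ_n) in Θ with g(θ_n) → 0, one has sup over t ≥ 0 of W_{ρ_α}(μP_t^{θ_n}, μP_t^{θ₀}) → 0 as n → ∞. -/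
open MeasureTheory ENNReal Filter

noncomputable section

/-- A coupling of two Borel probability measures: a measure on the product whose
marginals are the given measures. -/
def IsCoupling {X : Type*} [MeasurableSpace X] (μ ν : Measure X)
    (Γ : Measure (X × X)) : Prop :=
  Γ.map Prod.fst = μ ∧ Γ.map Prod.snd = ν

/-- The Wasserstein-like extension of a distance-like function `ρ` to probability
measures: the infimum over couplings of the integral of `ρ`. -/
noncomputable def wassLike {X : Type*} [MeasurableSpace X] (ρ : X → X → ℝ)
    (μ ν : Measure X) : ℝ≥0∞ :=
  ⨅ (Γ : Measure (X × X)) (_ : IsProbabilityMeasure Γ) (_ : IsCoupling μ ν Γ),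
    ∫⁻ p, ENNReal.ofReal (ρ p.1 p.2) ∂Γ

/-- A distance-like function: nonnegative, symmetric, lower semicontinuous, and
vanishing exactly on the diagonal. -/
def DistanceLike {X : Type*} [TopologicalSpace X] (ρ : X → X → ℝ) : Prop :=
  (∀ u v, 0 ≤ ρ u v) ∧ (∀ u v, ρ u v = ρ v u) ∧
    LowerSemicontinuous (fun p : X × X => ρ p.1 p.2) ∧
    (∀ u v, ρ u v = 0 ↔ u = v)

/-- A Markov kernel given as a measurable family of probability measures. -/
def IsMarkovKernelFun {X : Type*} [MeasurableSpace X] (P : X → Measure X) : Prop :=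
  Measurable P ∧ ∀ u, IsProbabilityMeasure (P u)

/-- The weighted distance-like function `ρ_a(u,v) = ρ(u,v)^{1/2} exp(a‖u‖² + a‖v‖²)`. -/
noncomputable def expWeight {X : Type*} [NormedAddCommGroup X]
    (ρ : X → X → ℝ) (a : ℝ) (u v : X) : ℝ :=
  Real.sqrt (ρ u v) * Real.exp (a * ‖u‖ ^ 2 + a * ‖v‖ ^ 2)

open ProbabilityTheory Topology
open scoped NNReal BoundedContinuousFunction

section Couplings

variable {X : Type*} [MeasurableSpace X] {μ ν κ : Measure X}

lemma wassLike_le_lintegral {c : X → X → ℝ} {Γ : Measure (X × X)} [IsProbabilityMeasure Γ]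
    (h : IsCoupling μ ν Γ) :
    wassLike c μ ν ≤ ∫⁻ p, ENNReal.ofReal (c p.1 p.2) ∂Γ :=
  iInf_le_of_le Γ (iInf_le_of_le inferInstance (iInf_le _ h))

lemma exists_isCoupling_of_wassLike_lt {c : X → X → ℝ} {B : ℝ≥0∞} (h : wassLike c μ ν < B) :
    ∃ Γ : Measure (X × X), IsProbabilityMeasure Γ ∧ IsCoupling μ ν Γ ∧
      ∫⁻ p, ENNReal.ofReal (c p.1 p.2) ∂Γ < B := by
  simpa only [wassLike, iInf_lt_iff, exists_prop] using h

lemma wassLike_mono {c c' : X → X → ℝ} (h : ∀ u v, c u v ≤ c' u v) :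
    wassLike c μ ν ≤ wassLike c' μ ν := by
  unfold wassLike
  gcongr with Γ _ _ p
  exact h _ _

lemma wassLike_comm {c : X → X → ℝ} (hs : ∀ u v, c u v = c v u)
    (hc : Measurable fun p : X × X => c p.1 p.2) : wassLike c μ ν = wassLike c ν μ := by
  have key : ∀ μ ν : Measure X, wassLike c μ ν ≤ wassLike c ν μ := by
    intro μ ν
    refine le_iInf fun Γ => le_iInf fun _ => le_iInf fun h => ?_
    have : IsProbabilityMeasure (Γ.map Prod.swap) :=
      Measure.isProbabilityMeasure_map measurable_swap.aemeasurable
    refine (wassLike_le_lintegral (Γ := Γ.map Prod.swap) ⟨?_, ?_⟩).trans ?_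
    · rw [Measure.map_map measurable_fst measurable_swap]; exact h.2
    · rw [Measure.map_map measurable_snd measurable_swap]; exact h.1
    · rw [lintegral_map hc.ennreal_ofReal measurable_swap]
      simp [hs]
  exact le_antisymm (key _ _) (key _ _)

lemma wassLike_self [IsProbabilityMeasure μ] {c : X → X → ℝ} (h : ∀ u, c u u = 0)
    (hc : Measurable fun p : X × X => c p.1 p.2) : wassLike c μ μ = 0 := by
  have hd : Measurable fun x : X => (x, x) := by fun_prop
  have : IsProbabilityMeasure (μ.map fun x => (x, x)) :=
    Measure.isProbabilityMeasure_map hd.aemeasurable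
  refine le_antisymm ((wassLike_le_lintegral (Γ := μ.map fun x => (x, x)) ⟨?_, ?_⟩).trans ?_) bot_le
  · rw [Measure.map_map measurable_fst hd]; exact Measure.map_id
  · rw [Measure.map_map measurable_snd hd]; exact Measure.map_id
  · rw [lintegral_map hc.ennreal_ofReal hd]
    simp [h]

lemma wassLike_dirac_le {c : X → X → ℝ} (hc : Measurable fun p : X × X => c p.1 p.2) (u v : X) :
    wassLike c (Measure.dirac u) (Measure.dirac v) ≤ ENNReal.ofReal (c u v) := by
  refine (wassLike_le_lintegral (Γ := Measure.dirac (u, v)) ⟨?_, ?_⟩).trans ?_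
  · rw [Measure.map_dirac' measurable_fst]
  · rw [Measure.map_dirac' measurable_snd]
  · rw [lintegral_dirac' _ hc.ennreal_ofReal]

/-- Gluing two couplings along their common marginal. -/
lemma wassLike_triangle [StandardBorelSpace X] {c c₁ c₂ : X → X → ℝ}
    (hc : Measurable fun p : X × X => c p.1 p.2)
    (hc₁ : Measurable fun p : X × X => c₁ p.1 p.2) (hc₂ : Measurable fun p : X × X => c₂ p.1 p.2)
    {C : ℝ≥0∞} (hC0 : C ≠ 0) (hC : C ≠ ⊤)
    (h : ∀ u v w, ENNReal.ofReal (c u v) ≤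
      C * (ENNReal.ofReal (c₁ u w) + ENNReal.ofReal (c₂ w v))) :
    wassLike c μ κ ≤ C * (wassLike c₁ μ ν + wassLike c₂ ν κ) := by
  have key : ∀ Γ₁ Γ₂ : Measure (X × X), IsProbabilityMeasure Γ₁ → IsCoupling μ ν Γ₁ →
      IsProbabilityMeasure Γ₂ → IsCoupling ν κ Γ₂ →
      wassLike c μ κ ≤ C * ((∫⁻ p, ENNReal.ofReal (c₁ p.1 p.2) ∂Γ₁)
        + ∫⁻ p, ENNReal.ofReal (c₂ p.1 p.2) ∂Γ₂) := by
    intro Γ₁ Γ₂ _ h₁ _ h₂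
    have : Nonempty X := (Measure.nonempty_of_neZero Γ₁).map Prod.fst
    set η : Kernel (X × X) X := Γ₂.condKernel.comap Prod.snd measurable_snd with hη
    have hf : Measurable fun q : (X × X) × X => (q.1.1, q.2) := by fun_prop
    have hs : Measurable fun q : (X × X) × X => (q.1.2, q.2) := by fun_prop
    have hfst : Γ₂.fst = Γ₁.map Prod.snd := h₂.1.trans h₁.2.symm
    have hglue : (Γ₁ ⊗ₘ η).map (fun q => (q.1.2, q.2)) = Γ₂ := by
      conv_rhs => rw [← Γ₂.disintegrate Γ₂.condKernel, hfst]
      ext s hms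
      rw [Measure.map_apply hs hms, Measure.compProd_apply (hs hms), Measure.compProd_apply hms,
        lintegral_map (Kernel.measurable_kernel_prodMk_left hms) measurable_snd]
      rfl
    have : IsProbabilityMeasure ((Γ₁ ⊗ₘ η).map fun q => (q.1.1, q.2)) :=
      Measure.isProbabilityMeasure_map hf.aemeasurable
    refine (wassLike_le_lintegral (Γ := (Γ₁ ⊗ₘ η).map fun q => (q.1.1, q.2)) ⟨?_, ?_⟩).trans ?_
    · rw [Measure.map_map measurable_fst hf, ← h₁.1]
      conv_rhs => rw [← Measure.fst_compProd Γ₁ η, Measure.fst,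
        Measure.map_map measurable_fst measurable_fst]
      rfl
    · rw [Measure.map_map measurable_snd hf, ← h₂.2]
      conv_rhs => rw [← hglue, Measure.map_map measurable_snd hs]
      rfl
    · rw [lintegral_map hc.ennreal_ofReal hf]
      calc ∫⁻ q, ENNReal.ofReal (c q.1.1 q.2) ∂(Γ₁ ⊗ₘ η)
          ≤ ∫⁻ q, C * (ENNReal.ofReal (c₁ q.1.1 q.1.2) + ENNReal.ofReal (c₂ q.1.2 q.2))
              ∂(Γ₁ ⊗ₘ η) := lintegral_mono fun q => h _ _ _
        _ = C * ((∫⁻ q, ENNReal.ofReal (c₁ q.1.1 q.1.2) ∂(Γ₁ ⊗ₘ η)) +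
              ∫⁻ q, ENNReal.ofReal (c₂ q.1.2 q.2) ∂(Γ₁ ⊗ₘ η)) := by
          rw [lintegral_const_mul' _ _ hC,
            lintegral_add_left (f := fun q : (X × X) × X => ENNReal.ofReal (c₁ q.1.1 q.1.2))
              (hc₁.ennreal_ofReal.comp measurable_fst)]
        _ = _ := by
          congr 2
          · conv_rhs => rw [← Measure.fst_compProd Γ₁ η, Measure.fst,
              lintegral_map hc₁.ennreal_ofReal measurable_fst]
          · conv_rhs => rw [← hglue, lintegral_map hc₂.ennreal_ofReal hs]
  rcases eq_or_ne (wassLike c₁ μ ν + wassLike c₂ ν κ) ⊤ with htop | htop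
  · simp [htop, ENNReal.mul_top hC0]
  obtain ⟨ht₁, ht₂⟩ := ENNReal.add_ne_top.1 htop
  have hlim : Tendsto (fun ε : ℝ≥0∞ => C * ((wassLike c₁ μ ν + ε) + (wassLike c₂ ν κ + ε)))
      (𝓝[>] 0) (𝓝 (C * ((wassLike c₁ μ ν + 0) + (wassLike c₂ ν κ + 0)))) := by
    have hid : Tendsto (fun ε : ℝ≥0∞ => ε) (𝓝[>] 0) (𝓝 0) := tendsto_id.mono_left inf_le_left
    exact ENNReal.Tendsto.const_mul ((tendsto_const_nhds.add hid).add
      (tendsto_const_nhds.add hid)) (Or.inr hC)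
  rw [add_zero, add_zero] at hlim
  refine ge_of_tendsto hlim ?_
  filter_upwards [self_mem_nhdsWithin] with ε hε
  obtain ⟨Γ₁, hp₁, h₁, hl₁⟩ :=
    exists_isCoupling_of_wassLike_lt (ENNReal.lt_add_right ht₁ (ne_of_gt hε))
  obtain ⟨Γ₂, hp₂, h₂, hl₂⟩ :=
    exists_isCoupling_of_wassLike_lt (ENNReal.lt_add_right ht₂ (ne_of_gt hε))
  grw [key Γ₁ Γ₂ hp₁ h₁ hp₂ h₂, hl₁, hl₂]

end Couplings

section Compactness

lemma isClosed_setOf_lintegral_le {Y : Type*} [TopologicalSpace Y] [PolishSpace Y]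
    [MeasurableSpace Y] [BorelSpace Y] {f : Y → ℝ} (hf : LowerSemicontinuous f) (h0 : 0 ≤ f)
    (B : ℝ≥0∞) :
    IsClosed {Γ : ProbabilityMeasure Y | ∫⁻ y, ENNReal.ofReal (f y) ∂(Γ : Measure Y) ≤ B} := by
  refine IsSeqClosed.isClosed fun Γs Γ hΓs hlim => ?_
  simp only [Set.mem_ofPred_eq] at hΓs ⊢
  calc ∫⁻ y, ENNReal.ofReal (f y) ∂(Γ : Measure Y)
      = ∫⁻ t in Set.Ioi (0 : ℝ), (Γ : Measure Y) {y | t < f y} :=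
        lintegral_eq_lintegral_meas_lt _ (Eventually.of_forall h0) hf.measurable.aemeasurable
    _ ≤ ∫⁻ t in Set.Ioi (0 : ℝ), atTop.liminf fun n => (Γs n : Measure Y) {y | t < f y} :=
        lintegral_mono fun t => ProbabilityMeasure.le_liminf_measure_open_of_tendsto hlim
          (hf.isOpen_preimage t)
    _ ≤ atTop.liminf fun n => ∫⁻ t in Set.Ioi (0 : ℝ), (Γs n : Measure Y) {y | t < f y} :=
        lintegral_liminf_le fun n => Antitone.measurable fun s t hst =>
          measure_mono fun y (hy : t < f y) => lt_of_le_of_lt hst hy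
    _ = atTop.liminf fun n => ∫⁻ y, ENNReal.ofReal (f y) ∂(Γs n : Measure Y) := by
        simp_rw [lintegral_eq_lintegral_meas_lt _ (Eventually.of_forall h0)
          hf.measurable.aemeasurable]
    _ ≤ B := (liminf_le_liminf (Eventually.of_forall hΓs)).trans (by simp)

variable {X : Type*} [TopologicalSpace X] [PolishSpace X] [MeasurableSpace X] [BorelSpace X]

lemma isCompact_setOf_isCoupling (μ ν : Measure X) [IsProbabilityMeasure μ]
    [IsProbabilityMeasure ν] :
    IsCompact {Γ : ProbabilityMeasure (X × X) | IsCoupling μ ν (Γ : Measure (X × X))} := by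
  have hcl : IsClosed {Γ : ProbabilityMeasure (X × X) | IsCoupling μ ν (Γ : Measure (X × X))} := by
    let μ' : ProbabilityMeasure X := ⟨μ, inferInstance⟩
    let ν' : ProbabilityMeasure X := ⟨ν, inferInstance⟩
    have : {Γ : ProbabilityMeasure (X × X) | IsCoupling μ ν (Γ : Measure (X × X))} =
        {Γ | Γ.map measurable_fst.aemeasurable = μ'} ∩
        {Γ | Γ.map measurable_snd.aemeasurable = ν'} := by
      ext Γ
      exact and_congr (Subtype.ext_iff (a1 := Γ.map measurable_fst.aemeasurable) (a2 := μ')).symm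
        (Subtype.ext_iff (a1 := Γ.map measurable_snd.aemeasurable) (a2 := ν')).symm
    rw [this]
    exact (isClosed_eq (ProbabilityMeasure.continuous_map continuous_fst) continuous_const).inter
      (isClosed_eq (ProbabilityMeasure.continuous_map continuous_snd) continuous_const)
  rw [← hcl.closure_eq]
  refine isCompact_closure_of_isTightMeasureSet (IsTightMeasureSet.prodMk ?_ ?_)
  · refine (isTightMeasureSet_singleton (μ := μ)).subset ?_
    rintro _ ⟨_, ⟨Γ, hΓ, rfl⟩, rfl⟩
    exact hΓ.1
  · refine (isTightMeasureSet_singleton (μ := ν)).subset ?_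
    rintro _ ⟨_, ⟨Γ, hΓ, rfl⟩, rfl⟩
    exact hΓ.2

/-- The Wasserstein-like extension is continuous along truncations of the cost. -/
lemma wassLike_le_of_forall_min_le {c : X → X → ℝ}
    (hc : LowerSemicontinuous fun p : X × X => c p.1 p.2) (h0 : ∀ u v, 0 ≤ c u v)
    {μ ν : Measure X} [IsProbabilityMeasure μ] [IsProbabilityMeasure ν] {B : ℝ≥0∞}
    (h : ∀ L : ℕ, wassLike (fun u v => min (c u v) L) μ ν ≤ B) : wassLike c μ ν ≤ B := by
  rcases eq_or_ne B ⊤ with rfl | hB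
  · exact le_top
  set b : ℕ → ℝ≥0∞ := fun n => B + (n : ℝ≥0∞)⁻¹ with hb
  have hb_anti : Antitone b := fun m n hmn => by
    simp only [hb]; gcongr
  have hb_lim : Tendsto b atTop (𝓝 B) := by
    simpa using (tendsto_const_nhds (x := B)).add ENNReal.tendsto_inv_nat_nhds_zero
  set t : ℕ → Set (ProbabilityMeasure (X × X)) := fun n =>
    {Γ | IsCoupling μ ν (Γ : Measure (X × X))} ∩
      {Γ | ∫⁻ p, ENNReal.ofReal (min (c p.1 p.2) n) ∂(Γ : Measure (X × X)) ≤ b n} with ht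
  have hclosed : ∀ n : ℕ, IsClosed {Γ : ProbabilityMeasure (X × X) |
      ∫⁻ p, ENNReal.ofReal (min (c p.1 p.2) n) ∂(Γ : Measure (X × X)) ≤ b n} := fun n =>
    isClosed_setOf_lintegral_le (hc.inf continuous_const.lowerSemicontinuous)
      (fun p => le_min (h0 _ _) n.cast_nonneg) _
  have hne := IsCompact.nonempty_iInter_of_sequence_nonempty_isCompact_isClosed t
    (fun n Γ hΓ => ⟨hΓ.1, by
      refine le_trans (lintegral_mono fun p => ?_) (hΓ.2.trans (hb_anti n.le_succ))
      gcongr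
      exact n.le_succ⟩)
    (fun n => by
      obtain ⟨Γ, hp, hΓ, hle⟩ := exists_isCoupling_of_wassLike_lt
        ((h n).trans_lt (ENNReal.lt_add_right hB (b := (n : ℝ≥0∞)⁻¹) (by simp)))
      exact ⟨⟨Γ, hp⟩, hΓ, hle.le⟩)
    ((isCompact_setOf_isCoupling μ ν).inter_right (hclosed 0))
    (fun n => (isCompact_setOf_isCoupling μ ν).isClosed.inter (hclosed n))
  obtain ⟨Γ, hΓ⟩ := hne
  rw [Set.mem_iInter] at hΓ
  refine (wassLike_le_lintegral (hΓ 0).1).trans ?_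
  have hmono : Monotone fun (n : ℕ) (p : X × X) => ENNReal.ofReal (min (c p.1 p.2) n) := by
    intro m n hmn p
    dsimp only
    gcongr
  have hlim := lintegral_tendsto_of_tendsto_of_monotone (μ := (Γ : Measure (X × X)))
    (f := fun (n : ℕ) (p : X × X) => ENNReal.ofReal (min (c p.1 p.2) n))
    (F := fun p => ENNReal.ofReal (c p.1 p.2))
    (fun n => (hc.measurable.min measurable_const).ennreal_ofReal.aemeasurable)
    (Eventually.of_forall fun p m n hmn => hmono hmn p)
    (Eventually.of_forall fun p => by
      refine tendsto_const_nhds.congr' ?_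
      filter_upwards [eventually_ge_atTop ⌈c p.1 p.2⌉₊] with n hn
      rw [min_eq_left (Nat.ceil_le.1 hn)])
  exact le_of_tendsto_of_tendsto' hlim hb_lim fun n => (hΓ n).2

end Compactness

section Mixtures

variable {X : Type*} [TopologicalSpace X] [PolishSpace X] [MeasurableSpace X] [BorelSpace X]

/-- Two probability measures admit a common function with finite integrals whose sublevel sets are
tight on the product. -/
lemma exists_coercive (μ ν : Measure X) [IsProbabilityMeasure μ] [IsProbabilityMeasure ν] :
    ∃ ψ : X → ℝ≥0∞, Measurable ψ ∧ ∫⁻ x, ψ x ∂μ ≠ ⊤ ∧ ∫⁻ x, ψ x ∂ν ≠ ⊤ ∧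
      ∀ M : ℝ≥0, ∃ S : Set (ProbabilityMeasure (X × X)), IsCompact S ∧
        ∀ Γ : ProbabilityMeasure (X × X),
          ∫⁻ p, (ψ p.1 + ψ p.2) ∂(Γ : Measure (X × X)) ≤ M → Γ ∈ S := by
  have htight : IsTightMeasureSet ({μ} ∪ {ν} : Set (Measure X)) :=
    isTightMeasureSet_singleton.union isTightMeasureSet_singleton
  rw [isTightMeasureSet_iff_exists_isCompact_measure_compl_le] at htight
  choose K hK hKle using fun n : ℕ => htight ((4 : ℝ≥0∞)⁻¹ ^ n) (ENNReal.pow_pos (by simp) n)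
  have hmeas : ∀ n, Measurable ((K n)ᶜ.indicator fun _ => (2 : ℝ≥0∞) ^ n) := fun n =>
    measurable_const.indicator (hK n).measurableSet.compl
  have hfin : ∀ m : Measure X, (∀ n, m (K n)ᶜ ≤ (4 : ℝ≥0∞)⁻¹ ^ n) →
      ∫⁻ x, ∑' n, (K n)ᶜ.indicator (fun _ => (2 : ℝ≥0∞) ^ n) x ∂m ≠ ⊤ := by
    intro m hm
    rw [lintegral_tsum fun n => (hmeas n).aemeasurable]
    refine ne_top_of_le_ne_top (b := ∑' n : ℕ, (2 : ℝ≥0∞)⁻¹ ^ n) ?_ (ENNReal.tsum_le_tsum fun n => ?_)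
    · simp [ENNReal.tsum_geometric]
    · rw [lintegral_indicator_const (hK n).measurableSet.compl]
      grw [hm n]
      rw [← mul_pow]
      gcongr
      rw [show (4 : ℝ≥0∞) = 2 * 2 by norm_num, ENNReal.mul_inv (by simp) (by simp), ← mul_assoc,
        ENNReal.mul_inv_cancel (by simp) (by simp), one_mul]
  refine ⟨fun x => ∑' n, (K n)ᶜ.indicator (fun _ => (2 : ℝ≥0∞) ^ n) x,
    Measurable.tsum hmeas, hfin μ fun n => hKle n μ (by simp),
    hfin ν fun n => hKle n ν (by simp), fun M => ?_⟩
  have hu : Tendsto (fun n : ℕ => M * (2 : ℝ≥0)⁻¹ ^ n) atTop (𝓝 0) := by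
    simpa using (tendsto_pow_atTop_nhds_zero_of_lt_one (r := (2 : ℝ≥0)⁻¹) (by simp)
      (by rw [← NNReal.coe_lt_coe]; norm_num)).const_mul M
  refine ⟨_, isCompact_setOfPred_probabilityMeasure_mass_eq_compl_isCompact_le hu
    (fun n => (hK n).prod (hK n)) (Or.inl inferInstance), fun Γ hΓ n => ?_⟩
  rw [← ENNReal.coe_le_coe, ProbabilityMeasure.ennreal_coeFn_eq_coeFn_toMeasure]
  have hle : ∀ n x, x ∈ (K n)ᶜ →
      (2 : ℝ≥0∞) ^ n ≤ ∑' n, (K n)ᶜ.indicator (fun _ => (2 : ℝ≥0∞) ^ n) x := fun n x hx => by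
    refine le_trans ?_ (ENNReal.le_tsum n)
    rw [Set.indicator_of_mem hx]
  have hmk := mul_meas_ge_le_lintegral₀ (μ := (Γ : Measure (X × X)))
    (f := fun p => (∑' n, (K n)ᶜ.indicator (fun _ => (2 : ℝ≥0∞) ^ n) p.1) +
      ∑' n, (K n)ᶜ.indicator (fun _ => (2 : ℝ≥0∞) ^ n) p.2)
    (((Measurable.tsum hmeas).comp measurable_fst).add
      ((Measurable.tsum hmeas).comp measurable_snd)).aemeasurable ((2 : ℝ≥0∞) ^ n)
  have hsub : (Γ : Measure (X × X)) (K n ×ˢ K n)ᶜ ≤ (Γ : Measure (X × X))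
      {p | (2 : ℝ≥0∞) ^ n ≤ (∑' n, (K n)ᶜ.indicator (fun _ => (2 : ℝ≥0∞) ^ n) p.1) +
        ∑' n, (K n)ᶜ.indicator (fun _ => (2 : ℝ≥0∞) ^ n) p.2} := by
    refine measure_mono fun p hp => ?_
    rw [Set.mem_compl_iff, Set.mem_prod, not_and_or] at hp
    rcases hp with hp | hp
    · exact (hle n p.1 hp).trans le_self_add
    · exact (hle n p.2 hp).trans le_add_self
  have h2 : (2 : ℝ≥0∞) ^ n * (Γ : Measure (X × X)) (K n ×ˢ K n)ᶜ ≤ M := by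
    grw [hsub]
    exact hmk.trans hΓ
  rw [mul_comm, ← ENNReal.le_div_iff_mul_le (by simp) (by simp)] at h2
  refine h2.trans_eq ?_
  rw [ENNReal.coe_mul, ENNReal.coe_pow, ENNReal.coe_inv (by simp), ← ENNReal.inv_pow, div_eq_mul_inv]
  rfl

/-- Finite mixtures of couplings of `κ ω` and `η ω` approximately couple `m.bind κ` and
`m.bind η`, as tested on finitely many functions. -/
lemma exists_mixture {Ω : Type*} [MeasurableSpace Ω] {m : Measure Ω} [IsProbabilityMeasure m]
    (κ η : Kernel Ω X) [IsMarkovKernel κ] [IsMarkovKernel η] {c : X → X → ℝ}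
    {ψ : X → ℝ≥0∞} (hψ : Measurable ψ)
    {h : Ω → ℝ≥0∞} (hh : Measurable h) (hle : ∀ ω, wassLike c (κ ω) (η ω) ≤ h ω)
    (hfin : ∫⁻ ω, h ω ∂m ≠ ⊤) (hψfin : ∫⁻ ω, (∫⁻ x, ψ x ∂κ ω + ∫⁻ x, ψ x ∂η ω) ∂m ≠ ⊤)
    {ι : Type*} [Fintype ι] (φ : ι → X →ᵇ ℝ) {ε : ℝ} (hε : 0 < ε) :
    ∃ Γ : Measure (X × X), IsProbabilityMeasure Γ ∧
      (∀ i, |∫ p, φ i p.1 ∂Γ - ∫ x, φ i x ∂(m.bind κ)| ≤ ε) ∧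
      (∀ i, |∫ p, φ i p.2 ∂Γ - ∫ x, φ i x ∂(m.bind η)| ≤ ε) ∧
      ∫⁻ p, ENNReal.ofReal (c p.1 p.2) ∂Γ ≤ ∫⁻ ω, h ω ∂m + ENNReal.ofReal ε ∧
      ∫⁻ p, (ψ p.1 + ψ p.2) ∂Γ ≤
        ∫⁻ ω, (∫⁻ x, ψ x ∂κ ω + ∫⁻ x, ψ x ∂η ω) ∂m + ENNReal.ofReal ε := by
  set Ψ : Ω → ℝ≥0∞ := fun ω => ∫⁻ x, ψ x ∂κ ω + ∫⁻ x, ψ x ∂η ω with hΨ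
  have hΨm : Measurable Ψ := hψ.lintegral_kernel.add hψ.lintegral_kernel
  set D : Set ((ι → ℝ) × (ι → ℝ) × ℝ × ℝ) := {v | ∃ Γ : Measure (X × X), IsProbabilityMeasure Γ ∧
    (∀ i, ∫ p, φ i p.1 ∂Γ = v.1 i) ∧ (∀ i, ∫ p, φ i p.2 ∂Γ = v.2.1 i) ∧
    (0 ≤ v.2.2.1 ∧ ∫⁻ p, ENNReal.ofReal (c p.1 p.2) ∂Γ ≤ ENNReal.ofReal v.2.2.1) ∧
    (0 ≤ v.2.2.2 ∧ ∫⁻ p, (ψ p.1 + ψ p.2) ∂Γ ≤ ENNReal.ofReal v.2.2.2)} with hD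
  have hint : ∀ (Γ : Measure (X × X)) [IsFiniteMeasure Γ] (f : X →ᵇ ℝ),
      Integrable (fun p => f p.1) Γ ∧ Integrable (fun p => f p.2) Γ := fun Γ _ f =>
    ⟨(f.compContinuous ⟨Prod.fst, continuous_fst⟩).integrable Γ,
      (f.compContinuous ⟨Prod.snd, continuous_snd⟩).integrable Γ⟩
  have hconv : Convex ℝ D := by
    rintro v ⟨Γ, _, hv₁, hv₂, ⟨hv₃, hv₃'⟩, hv₄, hv₄'⟩ w ⟨Γ', _, hw₁, hw₂, ⟨hw₃, hw₃'⟩, hw₄, hw₄'⟩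
      a b ha hb hab
    refine ⟨ENNReal.ofReal a • Γ + ENNReal.ofReal b • Γ', ⟨?_⟩, fun i => ?_, fun i => ?_,
      ⟨by simp; positivity, ?_⟩, by simp; positivity, ?_⟩
    · simp [← ENNReal.ofReal_add ha hb, hab]
    · rw [integral_add_measure ((hint Γ (φ i)).1.smul_measure (by simp))
        ((hint Γ' (φ i)).1.smul_measure (by simp)), integral_smul_measure, integral_smul_measure,
        hv₁, hw₁]
      simp [ENNReal.toReal_ofReal, ha, hb]
    · rw [integral_add_measure ((hint Γ (φ i)).2.smul_measure (by simp))
        ((hint Γ' (φ i)).2.smul_measure (by simp)), integral_smul_measure, integral_smul_measure,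
        hv₂, hw₂]
      simp [ENNReal.toReal_ofReal, ha, hb]
    · rw [lintegral_add_measure, lintegral_smul_measure, lintegral_smul_measure]
      simp only [Prod.snd_add, Prod.fst_add, Prod.smul_snd, Prod.smul_fst, smul_eq_mul]
      rw [ENNReal.ofReal_add (by positivity) (by positivity), ENNReal.ofReal_mul ha,
        ENNReal.ofReal_mul hb]
      gcongr
    · rw [lintegral_add_measure, lintegral_smul_measure, lintegral_smul_measure]
      simp only [Prod.snd_add, Prod.smul_snd, smul_eq_mul]
      rw [ENNReal.ofReal_add (by positivity) (by positivity), ENNReal.ofReal_mul ha,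
        ENNReal.ofReal_mul hb]
      gcongr
  set F : Ω → (ι → ℝ) × (ι → ℝ) × ℝ × ℝ := fun ω =>
    (fun i => ∫ x, φ i x ∂κ ω, fun i => ∫ x, φ i x ∂η ω, (h ω).toReal + ε / 2, (Ψ ω).toReal) with hF
  have hFD : ∀ᵐ ω ∂m, F ω ∈ D := by
    filter_upwards [ae_lt_top hh hfin, ae_lt_top hΨm hψfin] with ω hω hω'
    obtain ⟨Γ, hp, hΓ, hlt⟩ := exists_isCoupling_of_wassLike_lt ((hle ω).trans_lt
      (ENNReal.lt_add_right hω.ne (b := ENNReal.ofReal (ε / 2)) (by simpa using hε)))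
    refine ⟨Γ, hp, fun i => ?_, fun i => ?_, ⟨by positivity, hlt.le.trans_eq ?_⟩,
      by positivity, le_of_eq ?_⟩
    · simp only [hF, ← hΓ.1]
      rw [integral_map measurable_fst.aemeasurable (φ i).continuous.aestronglyMeasurable]
    · simp only [hF, ← hΓ.2]
      rw [integral_map measurable_snd.aemeasurable (φ i).continuous.aestronglyMeasurable]
    · rw [ENNReal.ofReal_add (by positivity) (by positivity), ENNReal.ofReal_toReal hω.ne]
    · rw [ENNReal.ofReal_toReal hω'.ne, lintegral_add_left (f := fun p : X × X => ψ p.1)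
        (hψ.comp measurable_fst), hΨ]
      simp only [← hΓ.1, ← hΓ.2]
      rw [lintegral_map hψ measurable_fst, lintegral_map hψ measurable_snd]
  have hI : ∀ (ξ : Kernel Ω X) [IsMarkovKernel ξ] (i : ι),
      Integrable (fun ω => ∫ x, φ i x ∂ξ ω) m := fun ξ _ i =>
    Integrable.integral_comp (κ := Kernel.const Unit m) (a := ()) ((φ i).integrable _)
  have hbind : ∀ (ξ : Kernel Ω X) [IsMarkovKernel ξ] (i : ι),
      ∫ ω, ∫ x, φ i x ∂ξ ω ∂m = ∫ x, φ i x ∂(m.bind ξ) := fun ξ _ i =>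
    (Kernel.integral_comp (κ := Kernel.const Unit m) (a := ()) ((φ i).integrable _)).symm
  have hI₁ : Integrable (fun ω i => ∫ x, φ i x ∂κ ω) m := Integrable.of_eval (hI κ)
  have hI₂ : Integrable (fun ω i => ∫ x, φ i x ∂η ω) m := Integrable.of_eval (hI η)
  have hI₃ : Integrable (fun ω => (h ω).toReal + ε / 2) m :=
    (integrable_toReal_of_lintegral_ne_top hh.aemeasurable hfin).add (integrable_const _)
  have hI₄ : Integrable (fun ω => (Ψ ω).toReal) m :=
    integrable_toReal_of_lintegral_ne_top hΨm.aemeasurable hψfin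
  have hI₃₄ := hI₃.prodMk hI₄
  have hI₂₃₄ := hI₂.prodMk hI₃₄
  have hFI : Integrable F m := hI₁.prodMk hI₂₃₄
  have hmem : ∫ ω, F ω ∂m ∈ closure D :=
    hconv.closure.integral_mem isClosed_closure (hFD.mono fun ω hω => subset_closure hω) hFI
  have hval : ∫ ω, F ω ∂m = (fun i => ∫ x, φ i x ∂(m.bind κ), fun i => ∫ x, φ i x ∂(m.bind η),
      (∫⁻ ω, h ω ∂m).toReal + ε / 2, (∫⁻ ω, Ψ ω ∂m).toReal) := by
    have hh' : ∫ ω, ((h ω).toReal + ε / 2) ∂m = (∫⁻ ω, h ω ∂m).toReal + ε / 2 := by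
      rw [integral_add (integrable_toReal_of_lintegral_ne_top hh.aemeasurable hfin)
        (integrable_const _), integral_toReal hh.aemeasurable (ae_lt_top hh hfin)]
      simp
    have hΨ' : ∫ ω, (Ψ ω).toReal ∂m = (∫⁻ ω, Ψ ω ∂m).toReal :=
      integral_toReal hΨm.aemeasurable (ae_lt_top hΨm hψfin)
    have e₁ : ∫ ω, (fun i => ∫ x, φ i x ∂κ ω) ∂m = fun i => ∫ x, φ i x ∂(m.bind κ) := by
      ext i; rw [eval_integral (hI κ), hbind κ]
    have e₂ : ∫ ω, (fun i => ∫ x, φ i x ∂η ω) ∂m = fun i => ∫ x, φ i x ∂(m.bind η) := by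
      ext i; rw [eval_integral (hI η), hbind η]
    rw [hF, integral_pair hI₁ hI₂₃₄, integral_pair hI₂ hI₃₄, integral_pair hI₃ hI₄, hh', hΨ', e₁, e₂]
  rw [hval] at hmem
  obtain ⟨v, ⟨Γ, hp, hv₁, hv₂, ⟨-, hv₃⟩, -, hv₄⟩, hdist⟩ :=
    Metric.mem_closure_iff.1 hmem (ε / 2) (half_pos hε)
  rw [dist_comm, Prod.dist_eq, Prod.dist_eq, Prod.dist_eq, max_lt_iff, max_lt_iff, max_lt_iff]
    at hdist
  obtain ⟨d₁, d₂, d₃, d₄⟩ := hdist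
  have hadd : ∀ {z : ℝ≥0∞} {x r : ℝ}, z ≠ ⊤ → 0 ≤ r → x ≤ z.toReal + r →
      ENNReal.ofReal x ≤ z + ENNReal.ofReal r := by
    intro z x r hz hr hx
    rw [← ENNReal.ofReal_toReal hz, ← ENNReal.ofReal_add ENNReal.toReal_nonneg hr]
    exact ENNReal.ofReal_le_ofReal hx
  refine ⟨Γ, hp, fun i => ?_, fun i => ?_, hv₃.trans (hadd hfin hε.le ?_),
    hv₄.trans (hadd hψfin hε.le ?_)⟩
  · rw [hv₁, ← Real.dist_eq]
    exact (dist_le_pi_dist _ _ i).trans (d₁.le.trans (half_le_self hε.le))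
  · rw [hv₂, ← Real.dist_eq]
    exact (dist_le_pi_dist _ _ i).trans (d₂.le.trans (half_le_self hε.le))
  · rw [Real.dist_eq, abs_lt] at d₃
    dsimp only at d₃
    linarith [d₃.2]
  · rw [Real.dist_eq, abs_lt] at d₄
    dsimp only at d₄
    linarith [d₄.2]

/-- The Wasserstein-like extension is jointly convex, for mixtures over an arbitrary probability
space. -/
lemma wassLike_bind_le {Ω : Type*} [MeasurableSpace Ω] {m : Measure Ω} [IsProbabilityMeasure m]
    (κ η : Kernel Ω X) [IsMarkovKernel κ] [IsMarkovKernel η] {c : X → X → ℝ}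
    (hc : LowerSemicontinuous fun p : X × X => c p.1 p.2) (h0 : ∀ u v, 0 ≤ c u v)
    {h : Ω → ℝ≥0∞} (hh : Measurable h) (hle : ∀ ω, wassLike c (κ ω) (η ω) ≤ h ω) :
    wassLike c (m.bind κ) (m.bind η) ≤ ∫⁻ ω, h ω ∂m := by
  rcases eq_or_ne (∫⁻ ω, h ω ∂m) ⊤ with htop | htop
  · simp [htop]
  obtain ⟨ψ, hψ, hψκ, hψη, hcpt⟩ := exists_coercive (m.bind κ) (m.bind η)
  have hmψ : ∀ (κ : Kernel Ω X), Measurable fun ω => ∫⁻ x, ψ x ∂κ ω := fun κ =>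
    hψ.lintegral_kernel
  set Ψ : Ω → ℝ≥0∞ := fun ω => ∫⁻ x, ψ x ∂κ ω + ∫⁻ x, ψ x ∂η ω with hΨ
  have hΨm : Measurable Ψ := (hmψ κ).add (hmψ η)
  have hΨfin : ∫⁻ ω, Ψ ω ∂m ≠ ⊤ := by
    rw [hΨ, lintegral_add_left (hmψ κ), ← Measure.lintegral_bind κ.measurable.aemeasurable
      hψ.aemeasurable, ← Measure.lintegral_bind η.measurable.aemeasurable hψ.aemeasurable]
    exact ENNReal.add_ne_top.2 ⟨hψκ, hψη⟩
  obtain ⟨S, hS, hSmem⟩ := hcpt ((∫⁻ ω, Ψ ω ∂m).toNNReal + 1)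
  set t : (X →ᵇ ℝ) × ℕ → Set (ProbabilityMeasure (X × X)) := fun i =>
    {Γ | |∫ p, i.1 p.1 ∂(Γ : Measure (X × X)) - ∫ x, i.1 x ∂(m.bind κ)| ≤ 1 / (i.2 + 1 : ℝ)} ∩
    {Γ | |∫ p, i.1 p.2 ∂(Γ : Measure (X × X)) - ∫ x, i.1 x ∂(m.bind η)| ≤ 1 / (i.2 + 1 : ℝ)} ∩
    {Γ | ∫⁻ p, ENNReal.ofReal (c p.1 p.2) ∂(Γ : Measure (X × X)) ≤
      ∫⁻ ω, h ω ∂m + ENNReal.ofReal (1 / (i.2 + 1 : ℝ))} with ht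
  have htclosed : ∀ i, IsClosed (t i) := by
    intro i
    refine (IsClosed.inter ?_ ?_).inter (isClosed_setOf_lintegral_le hc (fun p => h0 _ _) _)
    · exact isClosed_le (((ProbabilityMeasure.continuous_integral_boundedContinuousFunction
        (i.1.compContinuous ⟨Prod.fst, continuous_fst⟩)).sub continuous_const).abs)
        continuous_const
    · exact isClosed_le (((ProbabilityMeasure.continuous_integral_boundedContinuousFunction
        (i.1.compContinuous ⟨Prod.snd, continuous_snd⟩)).sub continuous_const).abs)
        continuous_const
  have hfip : (S ∩ ⋂ i, t i).Nonempty := by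
    refine hS.inter_iInter_nonempty t htclosed fun s => ?_
    obtain ⟨N, hN⟩ : ∃ N : ℕ, ∀ i ∈ s, i.2 ≤ N := ⟨s.sup Prod.snd, fun i hi => s.le_sup hi⟩
    obtain ⟨Γ, hp, h₁, h₂, h₃, h₄⟩ := exists_mixture κ η hψ hh hle htop hΨfin
      (fun i : s => i.1.1) (ε := 1 / (N + 1 : ℝ)) (by positivity)
    refine ⟨⟨Γ, hp⟩, hSmem _ (h₄.trans ?_), ?_⟩
    · rw [ENNReal.coe_add, ENNReal.coe_toNNReal hΨfin]
      gcongr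
      refine ENNReal.ofReal_le_one.2 ?_
      rw [div_le_one (by positivity)]
      linarith [(Nat.cast_nonneg N : (0 : ℝ) ≤ N)]
    · refine Set.mem_iInter₂.2 fun i hi => ?_
      have hNi : (1 / (N + 1 : ℝ)) ≤ 1 / (i.2 + 1 : ℝ) := by
        have : (i.2 : ℝ) ≤ N := by exact_mod_cast hN i hi
        gcongr
      refine ⟨⟨(h₁ ⟨i, hi⟩).trans hNi, (h₂ ⟨i, hi⟩).trans hNi⟩, h₃.trans ?_⟩
      gcongr
  obtain ⟨Γ, -, hΓ⟩ := hfip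
  rw [Set.mem_iInter] at hΓ
  have hlim : Tendsto (fun n : ℕ => 1 / (n + 1 : ℝ)) atTop (𝓝 0) :=
    tendsto_one_div_add_atTop_nhds_zero_nat
  have heq : ∀ a b : ℝ, (∀ n : ℕ, |a - b| ≤ 1 / (n + 1 : ℝ)) → a = b := fun a b hab =>
    sub_eq_zero.1 (abs_nonpos_iff.1 (ge_of_tendsto' hlim hab))
  have hcoup : IsCoupling (m.bind κ) (m.bind η) (Γ : Measure (X × X)) := by
    have := Measure.isProbabilityMeasure_map (μ := (Γ : Measure (X × X)))
      (measurable_fst (α := X) (β := X)).aemeasurable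
    have := Measure.isProbabilityMeasure_map (μ := (Γ : Measure (X × X)))
      (measurable_snd (α := X) (β := X)).aemeasurable
    constructor
    · refine ext_of_forall_integral_eq_of_IsFiniteMeasure fun φ => ?_
      rw [integral_map measurable_fst.aemeasurable φ.continuous.aestronglyMeasurable]
      exact heq _ _ fun n => (hΓ (φ, n)).1.1
    · refine ext_of_forall_integral_eq_of_IsFiniteMeasure fun φ => ?_
      rw [integral_map measurable_snd.aemeasurable φ.continuous.aestronglyMeasurable]
      exact heq _ _ fun n => (hΓ (φ, n)).1.2
  refine (wassLike_le_lintegral hcoup).trans ?_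
  have hlim' : Tendsto (fun n : ℕ => ∫⁻ ω, h ω ∂m + ENNReal.ofReal (1 / (n + 1 : ℝ))) atTop
      (𝓝 (∫⁻ ω, h ω ∂m)) := by
    simpa using (tendsto_const_nhds (x := ∫⁻ ω, h ω ∂m)).add (ENNReal.tendsto_ofReal hlim)
  exact ge_of_tendsto' hlim' fun n => (hΓ (0, n)).2

end Mixtures

section Contraction

variable {X : Type*} [MeasurableSpace X] {K : Kernel X X}

instance isMarkovKernel_pow [IsMarkovKernel K] (n : ℕ) : IsMarkovKernel (K ^ n) := by
  induction n with
  | zero => rw [pow_zero]; exact inferInstanceAs (IsMarkovKernel Kernel.id)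
  | succ n ih =>
    rw [pow_succ']
    exact Kernel.IsMarkovKernel.comp K (K ^ n)

variable (K) in
lemma bind_pow_zero (m : Measure X) : m.bind (K ^ 0 : Kernel X X) = m := by
  rw [pow_zero]; exact Measure.id_comp

variable (K) in
lemma bind_pow_succ (m : Measure X) (n : ℕ) :
    m.bind (K ^ (n + 1) : Kernel X X) = (m.bind (K ^ n : Kernel X X)).bind K := by
  rw [pow_succ', Measure.comp_assoc]; rfl

lemma bind_pow_eq_self {m : Measure X} (h : m.bind K = m) (n : ℕ) :
    m.bind (K ^ n : Kernel X X) = m := by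
  induction n with
  | zero => exact bind_pow_zero K m
  | succ n ih => rw [bind_pow_succ, ih, h]

lemma wassLike_bind_pow_le [IsMarkovKernel K] {e : X → X → ℝ} {k : ℝ≥0∞}
    (hK : ∀ m₁ m₂ : Measure X, IsProbabilityMeasure m₁ → IsProbabilityMeasure m₂ →
      wassLike e (m₁.bind K) (m₂.bind K) ≤ k * wassLike e m₁ m₂)
    (m₁ m₂ : Measure X) [IsProbabilityMeasure m₁] [IsProbabilityMeasure m₂] (n : ℕ) :
    wassLike e (m₁.bind (K ^ n : Kernel X X)) (m₂.bind (K ^ n : Kernel X X)) ≤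
      k ^ n * wassLike e m₁ m₂ := by
  induction n with
  | zero => rw [bind_pow_zero, bind_pow_zero, pow_zero, one_mul]
  | succ n ih =>
    rw [bind_pow_succ, bind_pow_succ]
    refine (hK _ _ inferInstance inferInstance).trans ?_
    grw [ih]
    rw [pow_succ', mul_assoc]

variable [TopologicalSpace X] [PolishSpace X] [BorelSpace X] [IsMarkovKernel K]

/-- Under a contraction, iterates started from any two laws merge in the truncated distance,
even if the initial distance is infinite. -/
lemma tendsto_wassLike_min_bind_pow {e : X → X → ℝ}
    (he : LowerSemicontinuous fun p : X × X => e p.1 p.2) (h0 : ∀ u v, 0 ≤ e u v)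
    {k : ℝ≥0∞} (hk : k < 1)
    (hK : ∀ m₁ m₂ : Measure X, IsProbabilityMeasure m₁ → IsProbabilityMeasure m₂ →
      wassLike e (m₁.bind K) (m₂.bind K) ≤ k * wassLike e m₁ m₂)
    (m₁ m₂ : Measure X) [IsProbabilityMeasure m₁] [IsProbabilityMeasure m₂] (L : ℕ) :
    Tendsto (fun n : ℕ => wassLike (fun u v => min (e u v) L) (m₁.bind (K ^ n : Kernel X X))
      (m₂.bind (K ^ n : Kernel X X))) atTop (𝓝 0) := by
  have hmin : LowerSemicontinuous fun p : X × X => min (e p.1 p.2) (L : ℝ) :=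
    he.inf continuous_const.lowerSemicontinuous
  have hle : ∀ (n : ℕ) (p : X × X), wassLike (fun u v => min (e u v) L) ((K ^ n : Kernel X X) p.1)
      ((K ^ n : Kernel X X) p.2) ≤ min (k ^ n * ENNReal.ofReal (e p.1 p.2)) L := by
    refine fun n p => le_min ?_ ?_
    · calc _ ≤ wassLike e ((K ^ n : Kernel X X) p.1) ((K ^ n : Kernel X X) p.2) :=
            wassLike_mono fun u v => min_le_left _ _
        _ ≤ k ^ n * wassLike e (Measure.dirac p.1) (Measure.dirac p.2) := by
            simpa [Measure.dirac_bind (Kernel.measurable _)] using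
              wassLike_bind_pow_le hK (Measure.dirac p.1) (Measure.dirac p.2) n
        _ ≤ _ := by gcongr; exact wassLike_dirac_le he.measurable _ _
    · refine (wassLike_le_lintegral (Γ := ((K ^ n : Kernel X X) p.1).prod
        ((K ^ n : Kernel X X) p.2)) ⟨by simp, by simp⟩).trans ?_
      calc _ ≤ ∫⁻ _, (L : ℝ≥0∞) ∂((K ^ n : Kernel X X) p.1).prod ((K ^ n : Kernel X X) p.2) := by
            refine lintegral_mono fun q => ?_
            rw [← ENNReal.ofReal_natCast]
            exact ENNReal.ofReal_le_ofReal (min_le_right _ _)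
        _ = L := by simp
  have hmeas : ∀ n : ℕ, Measurable fun p : X × X =>
      min (k ^ n * ENNReal.ofReal (e p.1 p.2)) (L : ℝ≥0∞) := fun n =>
    (he.measurable.ennreal_ofReal.const_mul _).min measurable_const
  have hbound : ∀ n : ℕ, wassLike (fun u v => min (e u v) L) (m₁.bind (K ^ n : Kernel X X))
      (m₂.bind (K ^ n : Kernel X X)) ≤
        ∫⁻ p, min (k ^ n * ENNReal.ofReal (e p.1 p.2)) L ∂(m₁.prod m₂) := by
    intro n
    have h := wassLike_bind_le (m := m₁.prod m₂) ((K ^ n).comap Prod.fst measurable_fst)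
      ((K ^ n).comap Prod.snd measurable_snd) hmin
      (fun u v => le_min (h0 u v) (Nat.cast_nonneg L)) (hmeas n) (hle n)
    rw [← Kernel.comp_deterministic_eq_comap, ← Kernel.comp_deterministic_eq_comap,
      ← Measure.comp_assoc, ← Measure.comp_assoc, Measure.deterministic_comp_eq_map,
      Measure.deterministic_comp_eq_map] at h
    simpa using h
  refine tendsto_of_tendsto_of_tendsto_of_le_of_le tendsto_const_nhds ?_ (fun _ => bot_le) hbound
  have h := tendsto_lintegral_of_dominated_convergence (μ := m₁.prod m₂)
    (F := fun n p => min (k ^ n * ENNReal.ofReal (e p.1 p.2)) (L : ℝ≥0∞)) (f := fun _ => 0)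
    (fun _ => (L : ℝ≥0∞)) hmeas (fun n => Eventually.of_forall fun p => min_le_right _ _)
    (by simp) (Eventually.of_forall fun p => ?_)
  · simpa using h
  · have hpow : Tendsto (fun n : ℕ => k ^ n * ENNReal.ofReal (e p.1 p.2)) atTop (𝓝 0) := by
      simpa using ENNReal.Tendsto.mul_const (ENNReal.tendsto_pow_atTop_nhds_zero_of_lt_one hk)
        (Or.inr (ENNReal.ofReal_ne_top (r := e p.1 p.2)))
    exact tendsto_of_tendsto_of_tendsto_of_le_of_le tendsto_const_nhds hpow (fun _ => bot_le)
      fun n => min_le_left _ _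

/-- The distance of a law to an invariant measure of a contractive kernel is controlled by its
one-step displacement. -/
lemma wassLike_invariant_le {e₃ e₄ e₅ : X → X → ℝ}
    (he₃ : LowerSemicontinuous fun p : X × X => e₃ p.1 p.2)
    (he₄ : LowerSemicontinuous fun p : X × X => e₄ p.1 p.2)
    (he₅ : LowerSemicontinuous fun p : X × X => e₅ p.1 p.2)
    (h₃ : ∀ u v, 0 ≤ e₃ u v) (h₄ : ∀ u v, 0 ≤ e₄ u v) (h₄₅ : ∀ u v, e₄ u v ≤ e₅ u v)
    (hself : ∀ u, e₄ u u = 0)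
    {C k : ℝ≥0∞} (hC : 1 ≤ C) (hC' : C ≠ ⊤) (hCk : C * k ≤ 2⁻¹)
    (ht₃ : ∀ u v w, ENNReal.ofReal (e₃ u v) ≤
      C * (ENNReal.ofReal (e₄ u w) + ENNReal.ofReal (e₄ w v)))
    (ht₄ : ∀ u v w, ENNReal.ofReal (e₄ u v) ≤
      C * (ENNReal.ofReal (e₅ u w) + ENNReal.ofReal (e₅ w v)))
    (hK : ∀ m₁ m₂ : Measure X, IsProbabilityMeasure m₁ → IsProbabilityMeasure m₂ →
      wassLike e₅ (m₁.bind K) (m₂.bind K) ≤ k * wassLike e₄ m₁ m₂)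
    (x ν : Measure X) [IsProbabilityMeasure x] [IsProbabilityMeasure ν] (hν : ν.bind K = ν) :
    wassLike e₃ x ν ≤ C * (2 * C * wassLike e₅ x (x.bind K)) := by
  have hC0 : C ≠ 0 := (zero_lt_one.trans_le hC).ne'
  have hk : k < 1 := by
    calc k ≤ C * k := le_mul_of_one_le_left bot_le hC
      _ ≤ 2⁻¹ := hCk
      _ < 1 := by simp [ENNReal.inv_lt_one]
  set δ := wassLike e₅ x (x.bind K)
  have hiter : ∀ n : ℕ, wassLike e₄ x (x.bind (K ^ n : Kernel X X)) ≤ 2 * C * δ := by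
    intro n
    induction n with
    | zero => rw [bind_pow_zero, wassLike_self hself he₄.measurable]; exact bot_le
    | succ n ih =>
      calc wassLike e₄ x (x.bind (K ^ (n + 1) : Kernel X X))
          ≤ C * (wassLike e₅ x (x.bind K) +
              wassLike e₅ (x.bind K) (x.bind (K ^ (n + 1) : Kernel X X))) :=
            wassLike_triangle he₄.measurable he₅.measurable he₅.measurable hC0 hC' ht₄
        _ ≤ C * (δ + k * (2 * C * δ)) := by
            rw [bind_pow_succ]
            grw [hK _ _ inferInstance inferInstance, ih]
        _ = C * δ + (C * k) * (2 * (C * δ)) := by ring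
        _ ≤ C * δ + 2⁻¹ * (2 * (C * δ)) := by gcongr
        _ = 2 * C * δ := by
            rw [← mul_assoc 2⁻¹, ENNReal.inv_mul_cancel (by simp) (by simp)]; ring
  refine wassLike_le_of_forall_min_le he₃ h₃ fun L => ?_
  have hmin : ∀ {e : X → X → ℝ}, (LowerSemicontinuous fun p : X × X => e p.1 p.2) →
      Measurable fun p : X × X => min (e p.1 p.2) (L : ℝ) := fun he =>
    he.measurable.min measurable_const
  have hlim := tendsto_wassLike_min_bind_pow he₄ h₄ hk
    (fun m₁ m₂ i₁ i₂ => (wassLike_mono h₄₅).trans (hK m₁ m₂ i₁ i₂)) x ν L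
  have hlim' := ENNReal.Tendsto.const_mul
    ((tendsto_const_nhds (x := 2 * C * δ)).add hlim) (Or.inr hC')
  rw [add_zero] at hlim'
  refine ge_of_tendsto' hlim' fun n => ?_
  rw [bind_pow_eq_self hν]
  refine (wassLike_triangle (ν := x.bind (K ^ n : Kernel X X)) (hmin he₃) he₄.measurable (hmin he₄)
    hC0 hC' fun u v w => ?_).trans (by gcongr; exact hiter n)
  rcases le_total (e₄ w v) L with h | h
  · rw [min_eq_left h]
    exact (ENNReal.ofReal_le_ofReal (min_le_left _ _)).trans (ht₃ u v w)
  · rw [min_eq_right h]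
    calc ENNReal.ofReal (min (e₃ u v) L) ≤ ENNReal.ofReal L :=
          ENNReal.ofReal_le_ofReal (min_le_right _ _)
      _ ≤ ENNReal.ofReal (e₄ u w) + ENNReal.ofReal L := le_add_self
      _ ≤ _ := le_mul_of_one_le_left bot_le hC

end Contraction

section UniformConvergence

variable {X : Type*} [MeasurableSpace X]

lemma IsMarkovKernelFun.isProbabilityMeasure_bind {P : X → Measure X} (hP : IsMarkovKernelFun P)
    (m : Measure X) [IsProbabilityMeasure m] : IsProbabilityMeasure (m.bind P) :=
  MeasureTheory.isProbabilityMeasure_bind hP.1.aemeasurable (Eventually.of_forall hP.2)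

variable [TopologicalSpace X] [PolishSpace X] [BorelSpace X]

lemma wassLike_bind_bind_le {c : X → X → ℝ}
    (hc : LowerSemicontinuous fun p : X × X => c p.1 p.2) (h0 : ∀ u v, 0 ≤ c u v)
    {P Q : X → Measure X} (hP : IsMarkovKernelFun P) (hQ : IsMarkovKernelFun Q)
    {f : X → ℝ≥0∞} (hf : Measurable f) {a b : ℝ≥0∞}
    (h : ∀ u, wassLike c (P u) (Q u) ≤ a * f u * b) (m : Measure X) [IsProbabilityMeasure m] :
    wassLike c (m.bind P) (m.bind Q) ≤ a * (∫⁻ u, f u ∂m) * b := by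
  have : IsMarkovKernel (⟨P, hP.1⟩ : Kernel X X) := ⟨hP.2⟩
  have : IsMarkovKernel (⟨Q, hQ.1⟩ : Kernel X X) := ⟨hQ.2⟩
  refine (wassLike_bind_le (m := m) (⟨P, hP.1⟩ : Kernel X X) ⟨Q, hQ.1⟩ hc h0
    ((hf.const_mul a).mul_const b) h).trans_eq ?_
  rw [lintegral_mul_const _ (hf.const_mul a), lintegral_const_mul _ hf]

/-- Contraction along a scale of six distances, each satisfying a triangle inequality up to the
next one, upgrades a finite-time error estimate to uniform-in-time convergence. -/
lemma tendsto_iSup_wassLike {Θ : Type*} {θ₀ : Θ} {P : Θ → ℝ → X → Measure X}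
    (hker : ∀ θ : Θ, ∀ t ≥ (0 : ℝ), IsMarkovKernelFun (P θ t))
    {μinv : Θ → Measure X} (hμprob : ∀ θ, IsProbabilityMeasure (μinv θ))
    (hinv : ∀ θ : Θ, ∀ t ≥ (0 : ℝ), (μinv θ).bind (P θ t) = μinv θ)
    {e : ℕ → X → X → ℝ} (he : ∀ j, LowerSemicontinuous fun p : X × X => e j p.1 p.2)
    (h0 : ∀ j u v, 0 ≤ e j u v) (hcomm : ∀ j u v, e j u v = e j v u) (hself : ∀ j u, e j u u = 0)
    (hmono : ∀ i j, i ≤ j → ∀ u v, e i u v ≤ e j u v)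
    {C : ℝ≥0∞} (hC : 1 ≤ C) (hC' : C ≠ ⊤)
    (htri : ∀ j < 5, ∀ u v w, ENNReal.ofReal (e j u v) ≤
      C * (ENNReal.ofReal (e (j + 1) u w) + ENNReal.ofReal (e (j + 1) w v)))
    {T : ℝ} (hT : 0 ≤ T) {k : ℝ → ℝ≥0∞} (hk : Antitone k) (hk' : ∀ t, k t ≠ ⊤)
    (hklim : Tendsto k atTop (𝓝 0))
    (hcontr : ∀ θ : Θ, θ ≠ θ₀ → ∀ t ≥ T, ∀ m₁ m₂ : Measure X, IsProbabilityMeasure m₁ →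
      IsProbabilityMeasure m₂ →
      wassLike (e 5) (m₁.bind (P θ t)) (m₂.bind (P θ t)) ≤ k t * wassLike (e 0) m₁ m₂)
    {φ : ℝ → ℝ≥0∞} (hφ : MonotoneOn φ (Set.Ici 0)) (hφ' : ∀ t, φ t ≠ ⊤)
    {f : X → ℝ≥0∞} (hf : Measurable f) {G : Θ → ℝ≥0∞}
    (herr : ∀ θ : Θ, ∀ t ≥ (0 : ℝ), ∀ u,
      wassLike (e 5) (P θ t u) (P θ₀ t u) ≤ φ t * f u * G θ)
    (hf₀ : ∫⁻ u, f u ∂(μinv θ₀) ≠ ⊤)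
    {μ : Measure X} [IsProbabilityMeasure μ] (hfμ : ∫⁻ u, f u ∂μ ≠ ⊤)
    (hμ : wassLike (e 1) μ (μinv θ₀) ≠ ⊤)
    {θseq : ℕ → Θ} (hθ : Tendsto (fun n => G (θseq n)) atTop (𝓝 0)) :
    Tendsto (fun n => ⨆ (t : ℝ) (_ : 0 ≤ t),
      wassLike (e 0) (μ.bind (P (θseq n) t)) (μ.bind (P θ₀ t))) atTop (𝓝 0) := by
  have hC0 : C ≠ 0 := (zero_lt_one.trans_le hC).ne'
  have hm : ∀ j, Measurable fun p : X × X => e j p.1 p.2 := fun j => (he j).measurable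
  have hprob : ∀ θ t, 0 ≤ t → ∀ (m : Measure X) [IsProbabilityMeasure m],
      IsProbabilityMeasure (m.bind (P θ t)) := fun θ t ht m _ =>
    (hker θ t ht).isProbabilityMeasure_bind m
  have tri : ∀ j < 5, ∀ m₁ m₂ m₃ : Measure X, wassLike (e j) m₁ m₃ ≤
      C * (wassLike (e (j + 1)) m₁ m₂ + wassLike (e (j + 1)) m₂ m₃) := fun j hj m₁ m₂ m₃ =>
    wassLike_triangle (hm _) (hm _) (hm _) hC0 hC' (htri j hj)
  have symm : ∀ j (m₁ m₂ : Measure X), wassLike (e j) m₁ m₂ = wassLike (e j) m₂ m₁ :=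
    fun j m₁ m₂ => wassLike_comm (hcomm j) (hm j)
  have mono : ∀ i j, i ≤ j → ∀ m₁ m₂ : Measure X, wassLike (e i) m₁ m₂ ≤ wassLike (e j) m₁ m₂ :=
    fun i j hij m₁ m₂ => wassLike_mono (hmono i j hij)
  have err : ∀ θ t, 0 ≤ t → ∀ (m : Measure X) [IsProbabilityMeasure m],
      wassLike (e 5) (m.bind (P θ t)) (m.bind (P θ₀ t)) ≤ φ t * (∫⁻ u, f u ∂m) * G θ :=
    fun θ t ht m _ => wassLike_bind_bind_le (he 5) (h0 5) (hker θ t ht) (hker θ₀ t ht) hf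
      (herr θ t ht) m
  have hx := hμprob θ₀
  set x := μinv θ₀
  set F := ∫⁻ u, f u ∂μ
  set M := wassLike (e 1) μ x
  obtain ⟨A, hA, hinvariant⟩ : ∃ A : ℝ≥0∞, A ≠ ⊤ ∧
      ∀ θ, θ ≠ θ₀ → wassLike (e 3) x (μinv θ) ≤ A * G θ := by
    have hlim : Tendsto (fun t => C * k t) atTop (𝓝 0) := by
      simpa using ENNReal.Tendsto.const_mul hklim (Or.inr hC')
    obtain ⟨T₀, hT₀k, hT₀⟩ := ((hlim.eventually_le_const (u := (2 : ℝ≥0∞)⁻¹) (by simp)).and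
      (eventually_ge_atTop T)).exists
    have hT₀0 : 0 ≤ T₀ := hT.trans hT₀
    refine ⟨C * (2 * C * (φ T₀ * ∫⁻ u, f u ∂x)), by finiteness [hφ' T₀], fun θ hθ₀ => ?_⟩
    have := hμprob θ
    have : IsMarkovKernel (⟨P θ T₀, (hker θ T₀ hT₀0).1⟩ : Kernel X X) := ⟨(hker θ T₀ hT₀0).2⟩
    have h := wassLike_invariant_le (K := ⟨P θ T₀, (hker θ T₀ hT₀0).1⟩) (he 3) (he 4) (he 5)
      (h0 3) (h0 4) (hmono 4 5 (by simp)) (hself 4) hC hC' hT₀k (htri 3 (by simp))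
      (htri 4 (by simp)) (fun m₁ m₂ i₁ i₂ => (hcontr θ hθ₀ T₀ hT₀ m₁ m₂ i₁ i₂).trans
        (by gcongr; exact mono 0 4 (by simp) _ _)) x (μinv θ) (hinv θ T₀ hT₀0)
    refine h.trans ?_
    have hδ : wassLike (e 5) x (x.bind (P θ T₀)) ≤ φ T₀ * (∫⁻ u, f u ∂x) * G θ := by
      rw [symm]
      have h := err θ T₀ hT₀0 x
      rwa [show x.bind (P θ₀ T₀) = x from hinv θ₀ T₀ hT₀0] at h
    calc C * (2 * C * wassLike (e 5) x (x.bind (P θ T₀)))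
        ≤ C * (2 * C * (φ T₀ * (∫⁻ u, f u ∂x) * G θ)) := by gcongr
      _ = _ := by ring
  set Q : ℝ → ℝ≥0∞ := fun t => C * C * M * k t with hQ
  set S : ℝ → ℝ≥0∞ := fun t => C * C * A * k t + C * A with hS
  have hS' : ∀ t, S t ≠ ⊤ := fun t => by
    have := hk' t
    finiteness
  have perturbed : ∀ θ, θ ≠ θ₀ → ∀ t ≥ T, wassLike (e 2) (μ.bind (P θ t)) x ≤ Q t + S t * G θ := by
    intro θ hθ₀ t ht
    have := hμprob θ
    calc wassLike (e 2) (μ.bind (P θ t)) x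
        ≤ C * (wassLike (e 3) (μ.bind (P θ t)) (μinv θ) + wassLike (e 3) (μinv θ) x) :=
          tri 2 (by simp) _ _ _
      _ ≤ C * (k t * wassLike (e 0) μ (μinv θ) + A * G θ) := by
          gcongr
          · refine (mono 3 5 (by simp) _ _).trans ?_
            have h := hcontr θ hθ₀ t ht μ (μinv θ) inferInstance inferInstance
            rwa [hinv θ t (hT.trans ht)] at h
          · rw [symm]; exact hinvariant θ hθ₀
      _ ≤ C * (k t * (C * (M + A * G θ)) + A * G θ) := by
          gcongr
          refine (tri 0 (by simp) μ x (μinv θ)).trans ?_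
          gcongr
          exact (mono 1 3 (by simp) _ _).trans (hinvariant θ hθ₀)
      _ = Q t + S t * G θ := by simp only [hQ, hS]; ring
  have affine : ∀ {a b : ℝ≥0∞}, b ≠ ⊤ →
      Tendsto (fun n => a + b * G (θseq n)) atTop (𝓝 a) := fun {a b} hb => by
    simpa using (tendsto_const_nhds (x := a)).add (ENNReal.Tendsto.const_mul hθ (Or.inr hb))
  have hzero : ∀ n, θseq n = θ₀ → ⨆ (t : ℝ) (_ : 0 ≤ t),
      wassLike (e 0) (μ.bind (P (θseq n) t)) (μ.bind (P θ₀ t)) = 0 := by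
    intro n hn
    refine le_antisymm (iSup₂_le fun t ht => ?_) bot_le
    have := hprob θ₀ t ht μ
    rw [hn, wassLike_self (hself 0) (hm 0)]
  by_cases hfreq : ∃ᶠ n in atTop, θseq n ≠ θ₀
  swap
  · simp only [not_frequently, not_not] at hfreq
    exact tendsto_const_nhds.congr' (hfreq.mono fun n hn => (hzero n hn).symm)
  have unperturbed : ∀ t ≥ T, wassLike (e 1) (μ.bind (P θ₀ t)) x ≤ C * Q t := by
    intro t ht
    refine ge_of_tendsto_of_frequently
      (affine (a := C * Q t) (b := C * (φ t * F + S t)) (by finiteness [hφ' t, hS' t]))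
      (hfreq.mono fun n hn => ?_)
    calc wassLike (e 1) (μ.bind (P θ₀ t)) x
        ≤ C * (wassLike (e 2) (μ.bind (P θ₀ t)) (μ.bind (P (θseq n) t)) +
            wassLike (e 2) (μ.bind (P (θseq n) t)) x) := tri 1 (by simp) _ _ _
      _ ≤ C * (φ t * F * G (θseq n) + (Q t + S t * G (θseq n))) := by
          gcongr
          · rw [symm]
            exact (mono 2 5 (by simp) _ _).trans (err _ t (hT.trans ht) μ)
          · exact perturbed _ hn t ht
      _ = _ := by ring
  have hsup : ∀ t₁ ≥ T, ∀ n, ⨆ (t : ℝ) (_ : 0 ≤ t),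
      wassLike (e 0) (μ.bind (P (θseq n) t)) (μ.bind (P θ₀ t)) ≤
        C * (Q t₁ + C * Q t₁) + (C * S t₁ + φ t₁ * F) * G (θseq n) := by
    intro t₁ ht₁ n
    by_cases hn : θseq n = θ₀
    · rw [hzero n hn]; exact bot_le
    refine iSup₂_le fun t ht => ?_
    rcases le_total t t₁ with htt | htt
    · calc wassLike (e 0) (μ.bind (P (θseq n) t)) (μ.bind (P θ₀ t))
          ≤ φ t * F * G (θseq n) := (mono 0 5 (by simp) _ _).trans (err _ t ht μ)
        _ ≤ φ t₁ * F * G (θseq n) := by gcongr; exact hφ ht (hT.trans ht₁) htt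
        _ ≤ (C * S t₁ + φ t₁ * F) * G (θseq n) := by gcongr; exact le_add_self
        _ ≤ _ := le_add_self
    · have hkt := hk htt
      calc wassLike (e 0) (μ.bind (P (θseq n) t)) (μ.bind (P θ₀ t))
          ≤ C * (wassLike (e 1) (μ.bind (P (θseq n) t)) x +
              wassLike (e 1) x (μ.bind (P θ₀ t))) := tri 0 (by simp) _ _ _
        _ ≤ C * ((Q t + S t * G (θseq n)) + C * Q t) := by
            gcongr
            · exact (mono 1 2 (by simp) _ _).trans (perturbed _ hn t (ht₁.trans htt))
            · rw [symm]; exact unperturbed t (ht₁.trans htt)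
        _ ≤ C * ((Q t₁ + S t₁ * G (θseq n)) + C * Q t₁) := by
            simp only [hQ, hS]; gcongr
        _ = C * (Q t₁ + C * Q t₁) + C * S t₁ * G (θseq n) := by ring
        _ ≤ _ := by gcongr; exact le_self_add
  have hQlim : Tendsto (fun t => C * (Q t + C * Q t)) atTop (𝓝 0) := by
    have h : Tendsto (fun t => C * (C * C * M + C * (C * C * M)) * k t) atTop (𝓝 0) := by
      simpa using ENNReal.Tendsto.const_mul hklim
        (Or.inr (show C * (C * C * M + C * (C * C * M)) ≠ ⊤ by finiteness))
    refine h.congr fun t => ?_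
    simp only [hQ]; ring
  rw [ENNReal.tendsto_nhds_zero]
  intro ε hε
  obtain ⟨t₁, ht₁ε, ht₁⟩ := ((hQlim.eventually_lt_const hε).and (eventually_ge_atTop T)).exists
  filter_upwards [(affine (b := C * S t₁ + φ t₁ * F)
    (by finiteness [hφ' t₁, hS' t₁])).eventually_lt_const ht₁ε] with n hn
  exact (hsup t₁ ht₁ n).trans hn.le

end UniformConvergence

section ExpWeight

variable {X : Type*} [NormedAddCommGroup X] {ρ : X → X → ℝ} {a b : ℝ}

lemma expWeight_nonneg (u v : X) : 0 ≤ expWeight ρ a u v := by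
  unfold expWeight; positivity

lemma DistanceLike.expWeight_comm (h : DistanceLike ρ) (u v : X) :
    expWeight ρ a u v = expWeight ρ a v u := by
  rw [expWeight, expWeight, h.2.1, add_comm]

lemma DistanceLike.expWeight_self (h : DistanceLike ρ) (u : X) : expWeight ρ a u u = 0 := by
  rw [expWeight, (h.2.2.2 u u).2 rfl, Real.sqrt_zero, zero_mul]

lemma expWeight_mono (hab : a ≤ b) (u v : X) : expWeight ρ a u v ≤ expWeight ρ b u v := by
  unfold expWeight; gcongr

lemma DistanceLike.lowerSemicontinuous_expWeight (h : DistanceLike ρ) :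
    LowerSemicontinuous fun p : X × X => expWeight ρ a p.1 p.2 := by
  have hs : LowerSemicontinuous fun p : X × X => Real.sqrt (ρ p.1 p.2) :=
    Real.continuous_sqrt.comp_lowerSemicontinuous h.2.2.1 Real.sqrt_monotone
  have hE : Continuous fun p : X × X => Real.exp (a * ‖p.1‖ ^ 2 + a * ‖p.2‖ ^ 2) := by fun_prop
  intro p y hy
  have hlt : ∀ q : X × X, y < expWeight ρ a q.1 q.2 ↔
      0 < Real.sqrt (ρ q.1 q.2) + -(y / Real.exp (a * ‖q.1‖ ^ 2 + a * ‖q.2‖ ^ 2)) := fun q => by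
    rw [expWeight, ← sub_eq_add_neg, sub_pos, div_lt_iff₀ (Real.exp_pos _)]
  have hsum := hs.add (continuous_const (y := y) |>.div hE
    fun q => (Real.exp_pos _).ne').neg.lowerSemicontinuous
  filter_upwards [hsum p 0 ((hlt p).1 hy)] with q hq
  exact (hlt q).2 hq

end ExpWeight

theorem uniform_in_time_weak_convergence
    {X : Type*} [NormedAddCommGroup X] [NormedSpace ℝ X] [CompleteSpace X]
    [SecondCountableTopology X] [MeasurableSpace X] [BorelSpace X]
    {Θ : Type*} (θ₀ : Θ)
    (P : Θ → ℝ → X → Measure X)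
    (hker : ∀ θ : Θ, ∀ t ≥ (0 : ℝ), IsMarkovKernelFun (P θ t))
    (Λ : Set (X → X → ℝ))
    (hΛ : ∀ ρ ∈ Λ, DistanceLike ρ ∧ ∀ u v : X, ρ u v ≤ 1)
    -- (H1) generalized triangle inequality for the weighted distances
    (γ : ℝ) (hγ : 1 ≤ γ)
    (hH1 : ∀ ρ ∈ Λ, ∀ α > (0 : ℝ), ∃ C > (0 : ℝ), ∀ u v w : X,
      expWeight ρ α u v ≤ C * (expWeight ρ (γ * α) u w + expWeight ρ (γ * α) w v))
    -- (H2) invariant measures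
    (μinv : Θ → Measure X) (hμprob : ∀ θ, IsProbabilityMeasure (μinv θ))
    (hH2 : ∀ θ : Θ, ∀ t ≥ (0 : ℝ), (μinv θ).bind (P θ t) = μinv θ)
    -- (H3) parameter-uniform Wasserstein contraction
    (hH3 : ∀ m : ℝ, 1 ≤ m → ∃ αm > (0 : ℝ), ∀ α ∈ Set.Ioc (0 : ℝ) αm, ∃ ρ ∈ Λ,
      ∃ T > (0 : ℝ), ∃ C₁ > (0 : ℝ), ∃ C₂ > (0 : ℝ), ∀ θ : Θ, θ ≠ θ₀ → ∀ t ≥ T,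
        ∀ μ ν : Measure X, IsProbabilityMeasure μ → IsProbabilityMeasure ν →
          wassLike (expWeight ρ α) (μ.bind (P θ t)) (ν.bind (P θ t))
            ≤ ENNReal.ofReal (C₁ * Real.exp (-C₂ * t))
              * wassLike (expWeight ρ (α / m)) μ ν)
    -- (H4') finite-time error estimate
    (α' : ℝ) (hα' : 0 < α')
    (g : Θ → ℝ) (hg0 : ∀ θ, 0 ≤ g θ)
    (φt : ℝ → ℝ) (hφt0 : ∀ t ≥ (0 : ℝ), 0 ≤ φt t)
    (f : X → ℝ≥0∞) (hf : Measurable f)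
    (hH4 : ∀ ρ ∈ Λ, ∀ a ∈ Set.Ioc (0 : ℝ) α', ∀ θ : Θ, ∀ t ≥ (0 : ℝ), ∀ u : X,
      wassLike (expWeight ρ a) (P θ t u) (P θ₀ t u)
        ≤ ENNReal.ofReal (φt t) * f u * ENNReal.ofReal (g θ))
    -- (H5) φ̃ is continuous and strictly increasing on [0,∞)
    (hH5 : ContinuousOn φt (Set.Ici (0 : ℝ)) ∧ StrictMonoOn φt (Set.Ici (0 : ℝ)))
    -- (H6) g is bounded
    (hH6 : ∃ B : ℝ, ∀ θ, g θ ≤ B)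
    -- (H7) finite f-moment of the limiting invariant measure
    (hH7 : (∫⁻ u, f u ∂(μinv θ₀)) < ⊤) :
    ∃ αhat > (0 : ℝ), ∀ α ∈ Set.Ioc (0 : ℝ) αhat, ∃ ρ ∈ Λ,
      ∀ μ : Measure X, IsProbabilityMeasure μ → (∫⁻ u, f u ∂μ) < ⊤ →
        wassLike (expWeight ρ (γ * α)) μ (μinv θ₀) < ⊤ →
        ∀ θseq : ℕ → Θ, Tendsto (fun n => g (θseq n)) atTop (nhds 0) →
          Tendsto
            (fun n => ⨆ (t : ℝ) (_ : 0 ≤ t),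
              wassLike (expWeight ρ α) (μ.bind (P (θseq n) t)) (μ.bind (P θ₀ t)))
            atTop (nhds 0) := by
  have hγ0 : 0 < γ := zero_lt_one.trans_le hγ
  obtain ⟨αm, hαm, hcontr⟩ := hH3 (γ ^ 5) (one_le_pow₀ hγ)
  refine ⟨min αm α' / γ ^ 5, by positivity, fun α hα => ?_⟩
  have hα0 : 0 < α := hα.1
  have hα5 : γ ^ 5 * α ≤ min αm α' := by
    rw [mul_comm]; exact (le_div_iff₀ (by positivity)).1 hα.2
  obtain ⟨ρ, hρ, T, hT, C₁, hC₁, C₂, hC₂, hcontr⟩ :=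
    hcontr (γ ^ 5 * α) ⟨by positivity, hα5.trans (min_le_left _ _)⟩
  refine ⟨ρ, hρ, fun μ hμ hfμ hμx θseq hθ => ?_⟩
  have hd := (hΛ ρ hρ).1
  choose c hc hctri using fun j : ℕ => hH1 ρ hρ (γ ^ j * α) (by positivity)
  have hcsum : 0 ≤ ∑ j ∈ Finset.range 5, c j := Finset.sum_nonneg fun j _ => (hc j).le
  have h := tendsto_iSup_wassLike (e := fun j => expWeight ρ (γ ^ j * α)) hker hμprob hH2
    (fun j => hd.lowerSemicontinuous_expWeight) (fun j => expWeight_nonneg)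
    (fun j => hd.expWeight_comm) (fun j => hd.expWeight_self)
    (fun i j hij => expWeight_mono (by gcongr))
    (C := ENNReal.ofReal (1 + ∑ j ∈ Finset.range 5, c j))
    (ENNReal.one_le_ofReal.2 (by linarith)) ENNReal.ofReal_ne_top ?_ hT.le
    (k := fun t => ENNReal.ofReal (C₁ * Real.exp (-C₂ * t))) ?_ (fun _ => ENNReal.ofReal_ne_top) ?_
    (fun θ hθ₀ t ht m₁ m₂ i₁ i₂ => ?_) (φ := fun t => ENNReal.ofReal (φt t))
    (fun s hs t ht hst => ENNReal.ofReal_le_ofReal (hH5.2.monotoneOn hs ht hst))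
    (fun _ => ENNReal.ofReal_ne_top) hf (G := fun θ => ENNReal.ofReal (g θ))
    (hH4 ρ hρ _ ⟨by positivity, hα5.trans (min_le_right _ _)⟩) hH7.ne (μ := μ) hfμ.ne
    (by simpa using hμx.ne) (by simpa using ENNReal.tendsto_ofReal hθ)
  · simpa using h
  · intro j hj u v w
    have hcj : c j ≤ 1 + ∑ i ∈ Finset.range 5, c i :=
      (Finset.single_le_sum (fun i _ => (hc i).le) (Finset.mem_range.2 hj)).trans (by linarith)
    rw [← ENNReal.ofReal_add (expWeight_nonneg _ _) (expWeight_nonneg _ _),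
      ← ENNReal.ofReal_mul (by linarith)]
    refine ENNReal.ofReal_le_ofReal ((hctri j u v w).trans ?_)
    rw [pow_succ', mul_assoc]
    have := add_nonneg (expWeight_nonneg (ρ := ρ) (a := γ * (γ ^ j * α)) u w)
      (expWeight_nonneg (ρ := ρ) (a := γ * (γ ^ j * α)) w v)
    gcongr
  · intro s t hst
    refine ENNReal.ofReal_le_ofReal ?_
    have : -C₂ * t ≤ -C₂ * s := by nlinarith
    gcongr
  · have hlim : Tendsto (fun t => C₁ * Real.exp (-C₂ * t)) atTop (𝓝 0) := by
      simpa using (Real.tendsto_exp_atBot.comp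
        (tendsto_id.const_mul_atTop_of_neg (neg_lt_zero.2 hC₂))).const_mul C₁
    simpa using ENNReal.tendsto_ofReal hlim
  · have h := hcontr θ hθ₀ t ht m₁ m₂ i₁ i₂
    rw [mul_div_cancel_left₀ _ (by positivity : γ ^ 5 ≠ 0)] at h
    simpa using h
end
end

section
/- Let X be a Polish space, let ρ : X × X → [0,∞) be a distance-like function, let P and Q be Markov kernels on X, and let μ be a Borel probability measure on X. Assume the map u ↦ W_ρ(P(u,·), Q(u,·)) is Borel measurable. Then W_ρ(μP, μQ) ≤ ∫_X W_ρ(P(u,·), Q(u,·)) μ(du). -/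
open MeasureTheory ENNReal Filter

noncomputable section

/-- Countably many real measurable functions are approximated uniformly by their compositions
with countably-valued maps, each measurable for the discrete σ-algebra on its codomain. -/
theorem exists_measurable_top_tendstoUniformly {X ι : Type*} [MeasurableSpace X] [Countable ι]
    (f : ι → X → ℝ) (hf : ∀ i, Measurable (f i)) :
    ∃ s : ℕ → X → X, (∀ k, Measurable[_, ⊤] (s k)) ∧
      ∀ i, TendstoUniformly (fun k u => f i (s k u)) (f i) atTop := by
  obtain ⟨e, he⟩ := exists_injective_nat ι
  have hfin : ∀ k, Finite {i // e i < k} := fun k =>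
    Finite.of_injective (fun i : {i // e i < k} => (⟨e i.1, i.2⟩ : Fin k))
      fun i j hij => Subtype.ext (he (Fin.mk.inj hij))
  let c : ∀ k : ℕ, X → ({i // e i < k} → ℤ) := fun k u i => ⌊f i u * (k + 1)⌋
  have hc : ∀ k, Measurable (c k) := fun k =>
    measurable_pi_lambda _ fun i => ((hf i).mul_const _).floor
  let s : ℕ → X → X := fun k u => Set.rangeSplitting (c k) ⟨c k u, u, rfl⟩
  have hs : ∀ k u, c k (s k u) = c k u := fun k u => Set.apply_rangeSplitting (c k) _
  refine ⟨s, fun k => ?_, fun i => ?_⟩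
  · have hg : Measurable[_, ⊤] (Set.rangeSplitting (c k)) :=
      fun A _ => (Set.to_countable _).measurableSet
    exact hg.comp ((hc k).subtype_mk (h := fun u => ⟨u, rfl⟩))
  · rw [Metric.tendstoUniformly_iff]
    intro ε hε
    obtain ⟨N, hN⟩ := exists_nat_one_div_lt hε
    filter_upwards [eventually_ge_atTop N, eventually_gt_atTop (e i)] with k hkN hki u
    have h1 := Int.abs_sub_lt_one_of_floor_eq_floor (congrFun (hs k u) ⟨i, hki⟩)
    have hk : (0 : ℝ) < k + 1 := by positivity
    rw [← sub_mul, abs_mul, abs_of_pos hk, ← lt_div_iff₀ hk] at h1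
    rw [dist_comm, Real.dist_eq]
    exact h1.trans ((one_div_le_one_div_of_le (by positivity) (by gcongr)).trans_lt hN)

/-- A countable family of Borel sets such that convergence of the measures of all its members
implies weak convergence of probability measures. -/
theorem exists_countable_convergence_determining (X : Type*) [TopologicalSpace X]
    [SecondCountableTopology X] [MeasurableSpace X] [OpensMeasurableSpace X] :
    ∃ S : Set (Set X), S.Countable ∧ (∀ A ∈ S, MeasurableSet A) ∧
      ∀ (ν : ℕ → ProbabilityMeasure X) (ν' : ProbabilityMeasure X),
        (∀ A ∈ S, Tendsto (fun k => ν k A) atTop (nhds (ν' A))) →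
          Tendsto ν atTop (nhds ν') := by
  classical
  let U : Finset (TopologicalSpace.countableBasis X) → Set X := fun F => ⋂ t ∈ F, (t : Set X)
  have : Countable (TopologicalSpace.countableBasis X) :=
    (TopologicalSpace.countable_countableBasis X).to_subtype
  have hU : ∀ A ∈ Set.range U, MeasurableSet A := by
    rintro _ ⟨F, rfl⟩
    exact F.measurableSet_biInter fun t _ =>
      (TopologicalSpace.isOpen_of_mem_countableBasis t.2).measurableSet
  have hpi : IsPiSystem (Set.range U) := by
    rintro _ ⟨F, rfl⟩ _ ⟨G, rfl⟩ _
    exact ⟨F ∪ G, by ext x; simp [U, or_imp, forall_and]⟩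
  refine ⟨Set.range U, Set.countable_range U, hU, fun ν ν' h => ?_⟩
  refine hpi.tendsto_probabilityMeasure_of_tendsto_of_mem hU (fun G hG x hx => ?_) h
  obtain ⟨t, ht, hxt, htG⟩ :=
    (TopologicalSpace.isBasis_countableBasis X).exists_subset_of_mem_open hx hG
  exact ⟨t, ⟨{⟨t, ht⟩}, Finset.set_biInter_singleton _ _⟩,
    (TopologicalSpace.isOpen_of_mem_countableBasis ht).mem_nhds hxt, htG⟩

/-- Averages of pointwise weakly converging probability kernels converge weakly. -/
theorem tendsto_bind_of_tendsto {X Y : Type*} [MeasurableSpace X] [TopologicalSpace Y]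
    [MeasurableSpace Y] [OpensMeasurableSpace Y] [HasOuterApproxClosed Y]
    (μ : Measure X) {κ : ℕ → X → ProbabilityMeasure Y} {κ' : X → ProbabilityMeasure Y}
    (hκ : ∀ k, Measurable fun u => (κ k u : Measure Y))
    (hκ' : Measurable fun u => (κ' u : Measure Y))
    (h : ∀ u, Tendsto (fun k => κ k u) atTop (nhds (κ' u)))
    {ν : ℕ → ProbabilityMeasure Y} {ν' : ProbabilityMeasure Y}
    (hν : ∀ k, (ν k : Measure Y) = μ.bind fun u => (κ k u : Measure Y))
    (hν' : (ν' : Measure Y) = μ.bind fun u => (κ' u : Measure Y)) :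
    Tendsto ν atTop (nhds ν') := by
  refine tendsto_of_forall_isOpen_le_liminf_nat' fun G hG => ?_
  have hνG : ∀ k, (ν k : Measure Y) G = ∫⁻ u, (κ k u : Measure Y) G ∂μ := fun k => by
    rw [hν, Measure.bind_apply hG.measurableSet (hκ k).aemeasurable]
  simp_rw [hνG]
  rw [hν', Measure.bind_apply hG.measurableSet hκ'.aemeasurable]
  calc ∫⁻ u, (κ' u : Measure Y) G ∂μ
      ≤ ∫⁻ u, liminf (fun k => (κ k u : Measure Y) G) atTop ∂μ :=
        lintegral_mono fun u => ProbabilityMeasure.le_liminf_measure_open_of_tendsto (h u) hG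
    _ ≤ _ := lintegral_liminf_le fun k =>
        (Measure.measurable_coe hG.measurableSet).comp (hκ k)

/-- The integral of a nonnegative lower semicontinuous function is lower semicontinuous
along weakly converging sequences of probability measures. -/
theorem lintegral_ofReal_le_liminf_of_lowerSemicontinuous {Y : Type*} [TopologicalSpace Y]
    [MeasurableSpace Y] [BorelSpace Y] [HasOuterApproxClosed Y]
    {f : Y → ℝ} (hf : LowerSemicontinuous f) (hf0 : ∀ y, 0 ≤ f y)
    {ν : ℕ → ProbabilityMeasure Y} {ν' : ProbabilityMeasure Y}
    (h : Tendsto ν atTop (nhds ν')) :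
    ∫⁻ y, ENNReal.ofReal (f y) ∂(ν' : Measure Y) ≤
      liminf (fun k => ∫⁻ y, ENNReal.ofReal (f y) ∂(ν k : Measure Y)) atTop := by
  simp_rw [lintegral_eq_lintegral_meas_lt _ (Eventually.of_forall hf0) hf.measurable.aemeasurable]
  refine (lintegral_mono fun t => ProbabilityMeasure.le_liminf_measure_open_of_tendsto h
    (hf.isOpen_preimage t)).trans ?_
  exact lintegral_liminf_le fun k => Antitone.measurable fun s t hst =>
    measure_mono fun ω hω => lt_of_le_of_lt hst hω

/-- A weakly convergent sequence of probability measures on a Polish space is tight. -/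
theorem isTightMeasureSet_range_of_tendsto {X : Type*} [TopologicalSpace X] [PolishSpace X]
    [MeasurableSpace X] [BorelSpace X] {ν : ℕ → ProbabilityMeasure X} {ν' : ProbabilityMeasure X}
    (h : Tendsto ν atTop (nhds ν')) :
    IsTightMeasureSet (Set.range fun k => (ν k : Measure X)) := by
  let := TopologicalSpace.upgradeIsCompletelyMetrizable X
  have hc : IsCompact (closure (Set.range ν)) :=
    h.isCompact_insert_range.closure_of_subset (Set.subset_insert _ _)
  refine (isTightMeasureSet_of_isCompact_closure hc).subset ?_
  rintro _ ⟨k, rfl⟩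
  exact ⟨ν k, ⟨k, rfl⟩, rfl⟩

/-- Couplings with weakly convergent marginals have a subsequence converging weakly to a coupling
of the limits. -/
theorem exists_subseq_tendsto_isCoupling {X : Type*} [TopologicalSpace X] [PolishSpace X]
    [MeasurableSpace X] [BorelSpace X] {ν₁ ν₂ : ℕ → ProbabilityMeasure X}
    {ν₁' ν₂' : ProbabilityMeasure X}
    (h₁ : Tendsto ν₁ atTop (nhds ν₁')) (h₂ : Tendsto ν₂ atTop (nhds ν₂'))
    {γ : ℕ → ProbabilityMeasure (X × X)} (hγ : ∀ k, IsCoupling (ν₁ k : Measure X) (ν₂ k) (γ k)) :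
    ∃ (γ' : ProbabilityMeasure (X × X)) (φ : ℕ → ℕ), StrictMono φ ∧
      Tendsto (γ ∘ φ) atTop (nhds γ') ∧ IsCoupling (ν₁' : Measure X) ν₂' γ' := by
  have hfst : ∀ k, (γ k).map (measurable_fst (α := X) (β := X)).aemeasurable = ν₁ k :=
    fun k => Subtype.ext (hγ k).1
  have hsnd : ∀ k, (γ k).map (measurable_snd (α := X) (β := X)).aemeasurable = ν₂ k :=
    fun k => Subtype.ext (hγ k).2
  have htight : IsTightMeasureSet {((η : ProbabilityMeasure (X × X)) : Measure (X × X)) |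
      η ∈ Set.range γ} := by
    refine IsTightMeasureSet.prodMk ((isTightMeasureSet_range_of_tendsto h₁).subset ?_)
      ((isTightMeasureSet_range_of_tendsto h₂).subset ?_)
    · rintro _ ⟨_, ⟨_, ⟨k, rfl⟩, rfl⟩, rfl⟩
      exact ⟨k, (hγ k).1.symm⟩
    · rintro _ ⟨_, ⟨_, ⟨k, rfl⟩, rfl⟩, rfl⟩
      exact ⟨k, (hγ k).2.symm⟩
  obtain ⟨γ', -, φ, hφ, hlim⟩ := (isCompact_closure_of_isTightMeasureSet htight).tendsto_subseq
    fun k => subset_closure (Set.mem_range_self (f := γ) k)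
  refine ⟨γ', φ, hφ, hlim, ?_, ?_⟩
  · have := ProbabilityMeasure.tendsto_map_of_tendsto_of_continuous _ _ hlim continuous_fst
    simp only [Function.comp_apply, hfst] at this
    exact congrArg ProbabilityMeasure.toMeasure (tendsto_nhds_unique this (h₁.comp hφ.tendsto_atTop))
  · have := ProbabilityMeasure.tendsto_map_of_tendsto_of_continuous _ _ hlim continuous_snd
    simp only [Function.comp_apply, hsnd] at this
    exact congrArg ProbabilityMeasure.toMeasure (tendsto_nhds_unique this (h₂.comp hφ.tendsto_atTop))

/-- Near-optimal couplings exist. -/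
theorem exists_isCoupling_lintegral_le {X : Type*} [MeasurableSpace X] (ρ : X → X → ℝ)
    (μ ν : Measure X) [IsProbabilityMeasure μ] [IsProbabilityMeasure ν]
    {ε : ℝ≥0∞} (hε : ε ≠ 0) :
    ∃ Γ : Measure (X × X), IsProbabilityMeasure Γ ∧ IsCoupling μ ν Γ ∧
      ∫⁻ p, ENNReal.ofReal (ρ p.1 p.2) ∂Γ ≤ wassLike ρ μ ν + ε := by
  by_cases htop : wassLike ρ μ ν = ∞
  · exact ⟨μ.prod ν, inferInstance, ⟨by simp, by simp⟩, by simp [htop]⟩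
  · have hlt : wassLike ρ μ ν < wassLike ρ μ ν + ε := ENNReal.lt_add_right htop hε
    conv at hlt => lhs; unfold wassLike
    simp only [iInf_lt_iff] at hlt
    obtain ⟨Γ, hΓ, hc, hle⟩ := hlt
    exact ⟨Γ, hΓ, hc, hle.le⟩

theorem map_bind_measure {X Y Z : Type*} [MeasurableSpace X] [MeasurableSpace Y]
    [MeasurableSpace Z] (μ : Measure X) {κ : X → Measure Y} (hκ : Measurable κ)
    {g : Y → Z} (hg : Measurable g) :
    (μ.bind κ).map g = μ.bind fun u => (κ u).map g := by
  ext A hA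
  have hκg : Measurable fun u => (κ u).map g := (Measure.measurable_map g hg).comp hκ
  rw [Measure.map_apply hg hA, Measure.bind_apply (hg hA) hκ.aemeasurable,
    Measure.bind_apply hA hκg.aemeasurable]
  simp_rw [Measure.map_apply hg hA]

/-- Convexity estimate (2.20) (cf. Villani, Theorem 4.8): the Wasserstein-like distance
between `μP` and `μQ` is bounded by the average of the pointwise distances between the
kernels. -/
theorem wassLike_bind_le_lintegral
    {X : Type*} [TopologicalSpace X] [PolishSpace X] [MeasurableSpace X] [BorelSpace X]
    (ρ : X → X → ℝ) (hρ : DistanceLike ρ)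
    (P Q : X → Measure X) (hP : IsMarkovKernelFun P) (hQ : IsMarkovKernelFun Q)
    (μ : Measure X) [IsProbabilityMeasure μ]
    (hmeas : Measurable (fun u => wassLike ρ (P u) (Q u))) :
    wassLike ρ (μ.bind P) (μ.bind Q) ≤ ∫⁻ u, wassLike ρ (P u) (Q u) ∂μ := by
  obtain ⟨hPm, hPp⟩ := hP
  obtain ⟨hQm, hQp⟩ := hQ
  refine ENNReal.le_of_forall_pos_le_add fun ε hε hfin => ?_
  have hε2 : (ε / 2 : NNReal) ≠ 0 := (half_pos hε).ne'
  set W : X → ℝ≥0∞ := fun u => wassLike ρ (P u) (Q u) with hW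
  have hWtop : ∀ᵐ u ∂μ, W u ≠ ∞ := (ae_lt_top hmeas hfin.ne).mono fun u hu => hu.ne
  obtain ⟨S, hSc, hSm, hS⟩ := exists_countable_convergence_determining X
  have := hSc.to_subtype
  have hreal : ∀ (κ : X → Measure X), Measurable κ → ∀ A : S, Measurable fun u => (κ u).real A :=
    fun κ hκ A => ((Measure.measurable_coe (hSm A A.2)).comp hκ).ennreal_toReal
  let f : (S ⊕ S) ⊕ Bool → X → ℝ := Sum.elim
    (Sum.elim (fun A u => (P u).real A) (fun A u => (Q u).real A))
    (fun b => if b then fun u => (W u).toReal else (W ⁻¹' {∞}).indicator 1)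
  have hf : ∀ i, Measurable (f i) := by
    rintro ((A | A) | (_ | _))
    · exact hreal P hPm A
    · exact hreal Q hQm A
    · exact measurable_one.indicator (hmeas (measurableSet_singleton _))
    · exact hmeas.ennreal_toReal
  obtain ⟨s, hsm, hs⟩ := exists_measurable_top_tendstoUniformly f hf
  have hcomp : ∀ {Y : Type _} [MeasurableSpace Y] (g : X → Y) (k : ℕ),
      Measurable fun u => g (s k u) := fun g k => measurable_from_top.comp (hsm k)
  have hWs : ∀ᶠ k in atTop, ∀ u, W u ≠ ∞ → W (s k u) ≤ W u + (ε / 2 : NNReal) := by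
    have h1 := Metric.tendstoUniformly_iff.1 (hs (.inr false)) 1 one_pos
    have h2 := Metric.tendstoUniformly_iff.1 (hs (.inr true)) (ε / 2 : NNReal) (half_pos hε)
    filter_upwards [h1, h2] with k h1 h2 u hu
    have hsu : W (s k u) ≠ ∞ := by
      intro h
      have := h1 u
      simp [f, Set.indicator, hu, h] at this
    have h2 := h2 u
    simp only [f, Sum.elim_inr, if_true, Real.dist_eq] at h2
    rw [← ENNReal.ofReal_toReal hsu, ← ENNReal.ofReal_toReal hu, ← ENNReal.ofReal_coe_nnreal,
      ← ENNReal.ofReal_add ENNReal.toReal_nonneg NNReal.zero_le_coe]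
    exact ENNReal.ofReal_le_ofReal (by linarith [neg_abs_le ((W u).toReal - (W (s k u)).toReal)])
  choose G hGp hGc hGle using fun u =>
    exists_isCoupling_lintegral_le ρ (P u) (Q u) (ENNReal.coe_ne_zero.2 hε2)
  have hprob : ∀ {Y : Type _} [MeasurableSpace Y] (κ : X → Measure Y), Measurable κ →
      (∀ u, IsProbabilityMeasure (κ u)) → IsProbabilityMeasure (μ.bind κ) :=
    fun κ hκ h => isProbabilityMeasure_bind hκ.aemeasurable (Eventually.of_forall h)
  have hlim : ∀ (κ : X → Measure X) (hκ : Measurable κ) (hκp : ∀ u, IsProbabilityMeasure (κ u)),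
      (∀ A : S, TendstoUniformly (fun k u => (κ (s k u)).real A) (fun u => (κ u).real A) atTop) →
      Tendsto (fun k => (⟨μ.bind fun u => κ (s k u), hprob _ (hcomp κ k) fun u => hκp _⟩ :
        ProbabilityMeasure X)) atTop
        (nhds (X := ProbabilityMeasure X) ⟨μ.bind κ, hprob κ hκ hκp⟩) := by
    intro κ hκ hκp h
    refine tendsto_bind_of_tendsto μ (κ := fun k u => ⟨κ (s k u), hκp _⟩)
      (κ' := fun u => ⟨κ u, hκp u⟩) (hcomp κ) hκ (fun u => hS _ _ fun A hA => ?_)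
      (fun k => rfl) rfl
    exact NNReal.tendsto_coe.1 ((h ⟨A, hA⟩).tendsto_at u)
  obtain ⟨γ', φ, hφ, hγ, hc⟩ := exists_subseq_tendsto_isCoupling
    (hlim P hPm hPp fun A => hs (.inl (.inl A))) (hlim Q hQm hQp fun A => hs (.inl (.inr A)))
    (γ := fun k => ⟨μ.bind fun u => G (s k u), hprob _ (hcomp G k) fun u => hGp _⟩) fun k => by
      constructor
      · change (μ.bind fun u => G (s k u)).map Prod.fst = μ.bind fun u => P (s k u)
        simp_rw [map_bind_measure μ (hcomp G k) measurable_fst, fun u => (hGc u).1]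
      · change (μ.bind fun u => G (s k u)).map Prod.snd = μ.bind fun u => Q (s k u)
        simp_rw [map_bind_measure μ (hcomp G k) measurable_snd, fun u => (hGc u).2]
  calc wassLike ρ (μ.bind P) (μ.bind Q)
      ≤ ∫⁻ p, ENNReal.ofReal (ρ p.1 p.2) ∂(γ' : Measure (X × X)) :=
        iInf_le_of_le _ (iInf_le_of_le γ'.2 (iInf_le_of_le hc le_rfl))
    _ ≤ _ := lintegral_ofReal_le_liminf_of_lowerSemicontinuous hρ.2.2.1
        (fun p => hρ.1 p.1 p.2) hγ
    _ ≤ ∫⁻ u, W u ∂μ + ε := by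
      refine liminf_le_of_frequently_le' (Eventually.frequently ?_)
      filter_upwards [hφ.tendsto_atTop.eventually hWs] with k hk
      calc ∫⁻ p, ENNReal.ofReal (ρ p.1 p.2) ∂(μ.bind fun u => G (s (φ k) u))
          ≤ ∫⁻ u, ∫⁻ p, ENNReal.ofReal (ρ p.1 p.2) ∂G (s (φ k) u) ∂μ :=
            Measure.lintegral_bind_le _ _ _
        _ ≤ ∫⁻ u, (W u + ε) ∂μ := by
          refine lintegral_mono_ae (hWtop.mono fun u hu => (hGle _).trans ?_)
          calc W (s (φ k) u) + (ε / 2 : NNReal) ≤ W u + (ε / 2 : NNReal) + (ε / 2 : NNReal) := by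
                gcongr; exact hk u hu
            _ = W u + ε := by rw [add_assoc, ← ENNReal.coe_add, add_halves]
        _ = ∫⁻ u, W u ∂μ + ε := by
          rw [lintegral_add_left hmeas, lintegral_const, measure_univ, mul_one]
end
end
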